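/- arXiv:2012.11897 — 4 statements merged into one kernel-verified Lean document; each statement's English description precedes it below -/
import Mathlib

section
/- Let p be a prime with p ≡ 1 (mod 3) and let y ∈ F_p* be non-cubic with y = g^e. Then the number of zeros of x_1³ + x_2³ + y·x_3³ = 0 over F_p is T_3(y) = p² + (1/2)·(p-1)·(−c − 9·δ_y(p)·d), where δ_y(p) = (-1)^{⟨e⟩_3}·sgn(Im(r_1 + 3√3·r_2·i)) = (-1)^{⟨e⟩_3}·sgn(r_2). -/
open Polynomial in
/-- A polynomial with integer coefficients takes at every root `μ` of `X ^ 2 + X + 1` a value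
`a + b * μ`, with coefficients `a`, `b` that depend only on the polynomial. -/
theorem exists_aeval_eq_add_mul_of_sq_add_self_add_one (P : ℤ[X]) :
    ∃ a b : ℤ, ∀ (R : Type) [CommRing R] (μ : R), μ ^ 2 + μ + 1 = 0 →
      aeval μ P = a + b * μ := by
  induction P using Polynomial.induction_on' with
  | add p q hp hq =>
    obtain ⟨a, b, h⟩ := hp
    obtain ⟨a', b', h'⟩ := hq
    refine ⟨a + a', b + b', fun R _ μ hμ ↦ ?_⟩
    rw [map_add, h R μ hμ, h' R μ hμ]
    push_cast
    ring
  | monomial n k =>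
    induction n with
    | zero => exact ⟨k, 0, fun R _ μ _ ↦ by simp⟩
    | succ n ih =>
      obtain ⟨a, b, h⟩ := ih
      refine ⟨-b, a - b, fun R _ μ hμ ↦ ?_⟩
      have h := h R μ hμ
      rw [aeval_monomial] at h ⊢
      rw [pow_succ, ← mul_assoc, h]
      push_cast
      linear_combination (b : R) * hμ

section FiniteField

variable {F : Type*} [Field F] [Fintype F]

theorem exists_pow_eq_of_forall_mem_zpowers {g : Fˣ} (hg : ∀ x : Fˣ, x ∈ Subgroup.zpowers g)
    {x : F} (hx : x ≠ 0) : ∃ n : ℕ, (g : F) ^ n = x := by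
  obtain ⟨n, hn⟩ := mem_powers_iff_mem_zpowers.mpr (hg (Units.mk0 x hx))
  exact ⟨n, by simpa using congrArg Units.val hn⟩

open Polynomial in
/-- The Jacobi sums `J(χ, χ)` of all cubic characters `χ` that send `g` to a root `μ` of
`X ^ 2 + X + 1`, in whatever ring, are given by the same expression `a + b * μ`. -/
theorem exists_jacobiSum_eq_add_mul {g : Fˣ} (hg : ∀ x : Fˣ, x ∈ Subgroup.zpowers g) :
    ∃ a b : ℤ, ∀ (R : Type) [CommRing R] (μ : R), μ ^ 2 + μ + 1 = 0 →
      ∀ χ : MulChar F R, χ g = μ → jacobiSum χ χ = a + b * μ := by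
  classical
  choose! ind hind using fun x : F ↦ exists_pow_eq_of_forall_mem_zpowers hg (x := x)
  obtain ⟨a, b, h⟩ := exists_aeval_eq_add_mul_of_sq_add_self_add_one
    (∑ x ∈ Finset.univ \ {(0 : F), 1}, (X : ℤ[X]) ^ (ind x + ind (1 - x)))
  refine ⟨a, b, fun R _ μ hμ χ hχ ↦ ?_⟩
  rw [← h R μ hμ, map_sum, jacobiSum_eq_sum_sdiff]
  refine Finset.sum_congr rfl fun x hx ↦ ?_
  simp only [Finset.mem_sdiff, Finset.mem_univ, Finset.mem_insert, Finset.mem_singleton, not_or,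
    true_and] at hx
  have h1 : 1 - x ≠ 0 := sub_ne_zero.mpr (Ne.symm hx.2)
  nth_rw 1 [← hind x hx.1, ← hind (1 - x) h1]
  simp [hχ, pow_add]

/-- A power character `x ↦ x ^ k` with `2 * k < #F - 1` has vanishing Jacobi sum. -/
theorem sum_pow_mul_one_sub_pow_eq_zero {k : ℕ} (hk : 2 * k < Fintype.card F - 1) :
    ∑ x : F, x ^ k * (1 - x) ^ k = 0 := by
  have h (x : F) : x ^ k * (1 - x) ^ k =
      ∑ m ∈ Finset.range (k + 1), (k.choose m * (-1) ^ m : F) * x ^ (k + m) := by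
    rw [sub_eq_add_neg, add_comm, add_pow, Finset.mul_sum]
    refine Finset.sum_congr rfl fun m _ ↦ ?_
    rw [neg_pow, one_pow, pow_add]
    ring
  simp_rw [h]
  rw [Finset.sum_comm]
  refine Finset.sum_eq_zero fun m hm ↦ ?_
  have hm := Finset.mem_range.mp hm
  rw [← Finset.mul_sum, FiniteField.sum_pow_lt_card_sub_one, mul_zero]
  omega

variable {R : Type*} [CommRing R]

theorem one_add_pow_add_sq_pow_eq_zero {ω : R} (hω : ω ^ 2 + ω + 1 = 0) {n : ℕ}
    (hn : ¬ 3 ∣ n) : 1 + ω ^ n + (ω ^ n) ^ 2 = 0 := by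
  have h3 : ω ^ 3 = 1 := by linear_combination (ω - 1) * hω
  have hlt := Nat.mod_lt n (by norm_num : 0 < 3)
  have h0 : n % 3 ≠ 0 := fun h ↦ hn (Nat.dvd_of_mod_eq_zero h)
  rw [← Nat.div_add_mod n 3, pow_add, pow_mul, h3, one_pow, one_mul]
  interval_cases n % 3
  · exact absurd rfl h0
  · linear_combination hω
  · linear_combination (ω ^ 2 - ω + 1) * hω

theorem isPrimitiveRoot_three_of_generator {g : Fˣ} (hg : ∀ x : Fˣ, x ∈ Subgroup.zpowers g)
    (h3 : 3 ∣ Fintype.card F - 1) :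
    IsPrimitiveRoot ((g : F) ^ ((Fintype.card F - 1) / 3)) 3 := by
  classical
  have ho : orderOf (g : F) = Fintype.card F - 1 := by
    rw [orderOf_units, orderOf_eq_card_of_forall_mem_zpowers hg, Nat.card_eq_fintype_card,
      Fintype.card_units]
  have hq := Fintype.one_lt_card (α := F)
  exact (ho ▸ IsPrimitiveRoot.orderOf (g : F)).pow (by omega) (Nat.div_mul_cancel h3).symm

theorem MulChar.apply_neg_one_of_apply_sq_add {g : Fˣ} (hg : ∀ x : Fˣ, x ∈ Subgroup.zpowers g)
    {χ : MulChar F R} (hχ : χ g ^ 2 + χ g + 1 = 0) : χ (-1) = 1 := by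
  obtain ⟨n, hn⟩ := exists_pow_eq_of_forall_mem_zpowers hg (neg_ne_zero.mpr (one_ne_zero (α := F)))
  have hω3 : χ g ^ 3 = 1 := by linear_combination (χ g - 1) * hχ
  have h : ((-1 : F)) ^ 3 = -1 := by ring
  rw [← h, map_pow, ← hn, map_pow, ← pow_mul, mul_comm, pow_mul, hω3, one_pow]

theorem MulChar.cube_eq_one_of_apply_sq_add {g : Fˣ} (hg : ∀ x : Fˣ, x ∈ Subgroup.zpowers g)
    {χ : MulChar F R} (hχ : χ g ^ 2 + χ g + 1 = 0) : χ ^ 3 = 1 := by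
  ext x
  obtain ⟨n, hn⟩ := exists_pow_eq_of_forall_mem_zpowers hg x.ne_zero
  have hω3 : χ g ^ 3 = 1 := by linear_combination (χ g - 1) * hχ
  rw [MulChar.pow_apply_coe, MulChar.one_apply_coe, ← hn, map_pow, ← pow_mul, mul_comm, pow_mul,
    hω3, one_pow]

/-- The number of cube roots of `a`, in terms of a cubic character. -/
theorem card_filter_cube_eq [DecidableEq F] {g : Fˣ} (hg : ∀ x : Fˣ, x ∈ Subgroup.zpowers g)
    (h3 : 3 ∣ Fintype.card F - 1) {χ : MulChar F R} (hχ : χ g ^ 2 + χ g + 1 = 0) (a : F) :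
    ((Finset.univ.filter fun x : F ↦ x ^ 3 = a).card : R) = 1 + χ a + χ a ^ 2 := by
  rcases eq_or_ne a 0 with rfl | ha
  · simp [Finset.filter_eq', χ.map_zero]
  obtain ⟨n, rfl⟩ := exists_pow_eq_of_forall_mem_zpowers hg ha
  have hω3 : χ g ^ 3 = 1 := by linear_combination (χ g - 1) * hχ
  by_cases hcube : ∃ x : F, x ^ 3 = g ^ n
  · have hroot := isPrimitiveRoot_three_of_generator hg h3
    have hcard : (Finset.univ.filter fun x : F ↦ x ^ 3 = g ^ n).card = 3 := by
      have hfin : (Finset.univ.filter fun x : F ↦ x ^ 3 = g ^ n) =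
          (Polynomial.nthRoots 3 ((g : F) ^ n)).toFinset := by
        ext x
        simp [Polynomial.mem_nthRoots]
      rw [hfin, Multiset.toFinset_card_of_nodup (hroot.nthRoots_nodup ha), hroot.card_nthRoots,
        if_pos hcube]
    obtain ⟨x, hx⟩ := hcube
    have hx0 : x ≠ 0 := by
      rintro rfl
      exact ha (by rw [← hx]; simp)
    obtain ⟨m, rfl⟩ := exists_pow_eq_of_forall_mem_zpowers hg hx0
    rw [hcard, ← hx]
    simp only [map_pow, ← pow_mul, mul_comm m, mul_assoc]
    simp only [pow_mul, hω3, one_pow]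
    norm_num
  · have hn : ¬ 3 ∣ n := by
      rintro ⟨m, rfl⟩
      exact hcube ⟨g ^ m, by rw [← pow_mul, mul_comm]⟩
    rw [map_pow, one_add_pow_add_sq_pow_eq_zero hχ hn, Finset.filter_false_of_mem]
    · simp
    · exact fun x _ hx ↦ hcube ⟨x, hx⟩

variable [IsDomain R]

/-- The number of solutions of `u ^ 3 + v ^ 3 = t` for `t ≠ 0`, written as a convolution. -/
theorem sum_cubic_mul_cubic_sub {χ ψ : MulChar F R} (hχ1 : χ ≠ 1) (hψ : ψ = χ⁻¹)
    (hψ2 : ψ = χ ^ 2) (hneg : χ (-1) = 1) {t : F} (ht : t ≠ 0) :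
    ∑ u : F, (1 + χ u + ψ u) * (1 + χ (t - u) + ψ (t - u)) =
      Fintype.card F - 2 + ψ t * jacobiSum χ χ + χ t * jacobiSum ψ ψ := by
  have hψ1 : ψ ≠ 1 := by rw [hψ]; exact inv_ne_one.mpr hχ1
  have hsub (φ : MulChar F R) (hφ : φ ≠ 1) : ∑ v : F, φ (1 - v) = 0 := by
    rw [← MulChar.sum_eq_zero_of_ne_one hφ]
    exact (Equiv.subLeft (1 : F)).sum_comp φ
  have hJ : jacobiSum χ ψ = -1 := by rw [hψ, jacobiSum_nontrivial_inv hχ1, hneg]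
  have hJ' : jacobiSum ψ χ = -1 := by rw [jacobiSum_comm, hJ]
  have hψt : ψ t = χ t ^ 2 := by rw [hψ2, MulChar.pow_apply' _ two_ne_zero]
  have hχt : χ t * ψ t = 1 := by
    rw [hψ, ← MulChar.mul_apply, mul_inv_cancel, MulChar.one_apply (isUnit_iff_ne_zero.mpr ht)]
  rw [← Equiv.sum_comp (Equiv.mulLeft₀ t ht) fun u ↦ (1 + χ u + ψ u) * (1 + χ (t - u) + ψ (t - u))]
  have hexp (v : F) : (1 + χ (t * v) + ψ (t * v)) * (1 + χ (t - t * v) + ψ (t - t * v)) =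
      1 + χ t * χ v + ψ t * ψ v + χ t * χ (1 - v) + ψ t * ψ (1 - v) +
        ψ t * (χ v * χ (1 - v)) + χ t * (ψ v * ψ (1 - v)) + χ v * ψ (1 - v) +
        ψ v * χ (1 - v) := by
    have : t - t * v = t * (1 - v) := by ring
    rw [this]
    simp only [map_mul]
    have h4 : ψ t * ψ t = χ t := by linear_combination ψ t * hψt + χ t * hχt
    linear_combination (χ v * ψ (1 - v) + ψ v * χ (1 - v)) * hχt
      + (ψ v * ψ (1 - v)) * h4 - (χ v * χ (1 - v)) * hψt
  simp only [Equiv.mulLeft₀_apply, hexp, Finset.sum_add_distrib, ← Finset.mul_sum,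
    MulChar.sum_eq_zero_of_ne_one hχ1, MulChar.sum_eq_zero_of_ne_one hψ1, hsub χ hχ1, hsub ψ hψ1]
  rw [jacobiSum] at hJ hJ'
  simp only [hJ, hJ', jacobiSum, Finset.sum_const, Finset.card_univ, nsmul_eq_mul]
  ring

/-- The number of solutions of `u ^ 3 + v ^ 3 = 0`, written as a convolution. -/
theorem sum_cubic_mul_cubic_zero_sub {χ ψ : MulChar F R} (hχ1 : χ ≠ 1) (hψ : ψ = χ⁻¹) (hψ2 : ψ = χ ^ 2)
    (hneg : χ (-1) = 1) :
    ∑ u : F, (1 + χ u + ψ u) * (1 + χ (0 - u) + ψ (0 - u)) = 3 * Fintype.card F - 2 := by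
  classical
  have hψ1 : ψ ≠ 1 := by rw [hψ]; exact inv_ne_one.mpr hχ1
  have hexp (u : F) : (1 + χ u + ψ u) * (1 + χ (0 - u) + ψ (0 - u)) =
      1 + 3 * χ u + 3 * ψ u + 2 * (1 : MulChar F R) u := by
    have hψu : ψ u = χ u ^ 2 := by rw [hψ2, MulChar.pow_apply' _ two_ne_zero]
    have hχu : χ u * ψ u = (1 : MulChar F R) u := by
      rw [hψ, ← MulChar.mul_apply, mul_inv_cancel]
    have hneg' : ψ (-1) = 1 := by
      rw [hψ2, MulChar.pow_apply' _ two_ne_zero, hneg, one_pow]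
    rw [zero_sub, neg_eq_neg_one_mul, map_mul, map_mul, hneg, hneg', ← hχu]
    have hψψ : ψ u * ψ u = χ u := by
      rw [← MulChar.mul_apply]
      nth_rw 1 [hψ]
      rw [hψ2, pow_two, inv_mul_cancel_left]
    linear_combination hψψ - hψu
  simp only [hexp, Finset.sum_add_distrib, ← Finset.mul_sum,
    MulChar.sum_eq_zero_of_ne_one hχ1, MulChar.sum_eq_zero_of_ne_one hψ1,
    MulChar.sum_one_eq_card_units]
  have hcard : (Fintype.card F : R) = Fintype.card Fˣ + 1 := by
    exact_mod_cast congrArg (Nat.cast (R := R)) (Fintype.card_eq_card_units_add_one (α := F))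
  simp only [hcard, Finset.sum_const, Finset.card_univ, nsmul_eq_mul]
  ring

/-- The number of zeros of a diagonal cubic form `x₁³ + x₂³ + y x₃³` in terms of Jacobi sums. -/
theorem card_diagonal_cubic_eq {g : Fˣ} (hg : ∀ x : Fˣ, x ∈ Subgroup.zpowers g)
    (h3 : 3 ∣ Fintype.card F - 1) {χ : MulChar F R} (hχ : χ g ^ 2 + χ g + 1 = 0)
    (hχ1 : χ ≠ 1) {y : F} (hy : y ≠ 0) :
    (Nat.card {x : F × F × F // x.1 ^ 3 + x.2.1 ^ 3 + y * x.2.2 ^ 3 = 0} : R) =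
      Fintype.card F ^ 2 + (Fintype.card F - 1) *
        (χ y ^ 2 * jacobiSum χ χ + χ y * jacobiSum χ⁻¹ χ⁻¹) := by
  classical
  have hχ3 := MulChar.cube_eq_one_of_apply_sq_add hg hχ
  have hneg := MulChar.apply_neg_one_of_apply_sq_add hg hχ
  have hinv : χ⁻¹ = χ ^ 2 := by
    rw [inv_eq_iff_mul_eq_one, ← pow_succ', hχ3]
  have hinv_apply (a : F) : χ⁻¹ a = χ a ^ 2 := by rw [hinv, MulChar.pow_apply' _ two_ne_zero]
  have hn (a : F) : ((Finset.univ.filter fun x : F ↦ x ^ 3 = a).card : R) =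
      1 + χ a + χ⁻¹ a := by
    rw [card_filter_cube_eq hg h3 hχ, hinv_apply]
  have hcube (f : F → R) : ∑ x : F, f (x ^ 3) = ∑ u : F, (1 + χ u + χ⁻¹ u) * f u := by
    rw [← Finset.sum_fiberwise Finset.univ (fun x : F ↦ x ^ 3)]
    refine Finset.sum_congr rfl fun u _ ↦ ?_
    rw [← hn, ← nsmul_eq_mul, ← Finset.sum_const]
    exact Finset.sum_congr rfl fun x hx ↦ by rw [(Finset.mem_filter.mp hx).2]
  have hcount : (Nat.card {x : F × F × F // x.1 ^ 3 + x.2.1 ^ 3 + y * x.2.2 ^ 3 = 0} : R) =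
      ∑ z : F, ∑ u : F, (1 + χ u + χ⁻¹ u) *
        (1 + χ (-(y * z ^ 3) - u) + χ⁻¹ (-(y * z ^ 3) - u)) := by
    rw [Nat.card_eq_fintype_card, Fintype.card_subtype, Finset.card_filter]
    push_cast
    simp only [Fintype.sum_prod_type]
    refine (Finset.sum_congr rfl fun a _ ↦ Finset.sum_comm).trans (Finset.sum_comm.trans ?_)
    refine Finset.sum_congr rfl fun z _ ↦ ?_
    rw [← hcube fun u ↦ 1 + χ (-(y * z ^ 3) - u) + χ⁻¹ (-(y * z ^ 3) - u)]
    refine Finset.sum_congr rfl fun a _ ↦ ?_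
    rw [← hn, Finset.card_filter]
    push_cast
    refine Finset.sum_congr rfl fun b _ ↦ if_congr ?_ rfl rfl
    constructor <;> intro h <;> linear_combination h
  have hz (z : F) (h : z ∈ Finset.univ.erase (0 : F)) :
      ∑ u : F, (1 + χ u + χ⁻¹ u) * (1 + χ (-(y * z ^ 3) - u) + χ⁻¹ (-(y * z ^ 3) - u)) =
        Fintype.card F - 2 + χ y ^ 2 * jacobiSum χ χ + χ y * jacobiSum χ⁻¹ χ⁻¹ := by
    have hz0 : z ≠ 0 := (Finset.mem_erase.mp h).1
    have hχz : χ (-(y * z ^ 3)) = χ y := by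
      rw [neg_eq_neg_one_mul, map_mul, hneg, map_mul, map_pow, one_mul,
        ← MulChar.pow_apply' χ three_ne_zero, hχ3, MulChar.one_apply hz0.isUnit, mul_one]
    rw [sum_cubic_mul_cubic_sub hχ1 rfl hinv hneg
      (neg_ne_zero.mpr (mul_ne_zero hy (pow_ne_zero 3 hz0))), hinv_apply, hχz]
  rw [hcount, ← Finset.add_sum_erase _ _ (Finset.mem_univ (0 : F)), Finset.sum_congr rfl hz]
  have h0 : -(y * (0 : F) ^ 3) = 0 := by ring
  rw [h0, sum_cubic_mul_cubic_zero_sub hχ1 rfl hinv hneg, Finset.sum_const, Finset.card_erase_of_mem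
    (Finset.mem_univ _), Finset.card_univ, nsmul_eq_mul, Nat.cast_sub Fintype.card_pos]
  push_cast
  ring

/-- A generator can be sent to any element `μ` whose order divides `#F - 1`. -/
theorem exists_mulChar_apply_generator_eq {g : Fˣ} (hg : ∀ x : Fˣ, x ∈ Subgroup.zpowers g)
    {S : Type*} [CommRing S] {n : ℕ} (hn0 : n ≠ 0) (hn : n ∣ Fintype.card F - 1) {μ : S}
    (hμ : μ ^ n = 1) : ∃ χ : MulChar F S, χ g = μ := by
  classical
  have hmem : Units.ofPowEqOne μ n hμ hn0 ∈ rootsOfUnity (Fintype.card Fˣ) S := by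
    obtain ⟨k, hk⟩ := hn
    rw [mem_rootsOfUnity, Fintype.card_units, hk, pow_mul, Units.pow_ofPowEqOne, one_pow]
  exact ⟨MulChar.ofRootOfUnity hmem hg, by rw [MulChar.ofRootOfUnity_spec]; rfl⟩

end FiniteField

theorem int_eq_zero_of_add_mul_eq_zero {K : Type*} [CommRing K] [CharZero K] {ω : K}
    (hω : ω ^ 2 + ω + 1 = 0) {m n : ℤ} (h : (m : K) + n * ω = 0) : m = 0 ∧ n = 0 := by
  have h1 : ((m ^ 2 - m * n + n ^ 2 : ℤ) : K) = 0 := by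
    push_cast
    linear_combination (m + n * ω ^ 2 : K) * h - (m * n + n ^ 2 * (ω - 1) : K) * hω
  have h2 : m ^ 2 - m * n + n ^ 2 = 0 := by exact_mod_cast h1
  have hm : m ^ 2 = 0 := by nlinarith [sq_nonneg (m - 2 * n), sq_nonneg m]
  have hn : n ^ 2 = 0 := by nlinarith [sq_nonneg (n - 2 * m), sq_nonneg n]
  exact ⟨pow_eq_zero_iff two_ne_zero |>.mp hm, pow_eq_zero_iff two_ne_zero |>.mp hn⟩

/-- A representation `4 p = c ^ 2 + 27 d ^ 2` with `c ≡ 1 mod 3` is unique up to the sign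
of `d`. -/
theorem four_mul_prime_eq_sq_add_unique {p : ℕ} (hp : p.Prime) {c d A B : ℤ}
    (h : 4 * (p : ℤ) = c ^ 2 + 27 * d ^ 2) (h' : 4 * (p : ℤ) = A ^ 2 + 27 * B ^ 2)
    (hc : c % 3 = 1) (hA : A % 3 = 1) : c = A ∧ (d = B ∨ d = -B) := by
  have hp0 : (0 : ℤ) < p := by exact_mod_cast hp.pos
  have key {D : ℤ} (hD : D ^ 2 = d ^ 2) (hdvd : (p : ℤ) ∣ c * B + D * A) : d ^ 2 = B ^ 2 := by
    have hid : 16 * (p : ℤ) ^ 2 = (c * A - 27 * D * B) ^ 2 + 27 * (c * B + D * A) ^ 2 := by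
      linear_combination (4 * (p : ℤ)) * h + (c ^ 2 + 27 * d ^ 2) * h' -
        27 * (A ^ 2 + 27 * B ^ 2) * hD
    obtain ⟨k, hk⟩ := hdvd
    have hk0 : k = 0 := by
      by_contra hne
      have hk1 : 1 ≤ k ^ 2 := Int.add_one_le_of_lt (a := 0) (by positivity)
      rw [hk] at hid
      nlinarith [sq_nonneg (c * A - 27 * D * B), mul_le_mul_of_nonneg_left hk1 (sq_nonneg (p : ℤ)),
        mul_pos hp0 hp0]
    have hzero : c * B + D * A = 0 := by rw [hk, hk0, mul_zero]
    have : 4 * (p : ℤ) * (d ^ 2 - B ^ 2) = 0 := by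
      linear_combination d ^ 2 * h' - B ^ 2 * h - A ^ 2 * hD + (D * A - c * B) * hzero
    rcases mul_eq_zero.mp this with h0 | h0
    · omega
    · linarith
  have hprod : (p : ℤ) ∣ (c * B + d * A) * (c * B + -d * A) :=
    ⟨4 * (B ^ 2 - d ^ 2), by linear_combination d ^ 2 * h' - B ^ 2 * h⟩
  have hdB : d ^ 2 = B ^ 2 := by
    rcases (Nat.prime_iff_prime_int.mp hp).dvd_or_dvd hprod with h1 | h1
    · exact key rfl h1
    · exact key (neg_sq d) h1
  have hcA : c ^ 2 = A ^ 2 := by linarith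
  refine ⟨?_, sq_eq_sq_iff_eq_or_eq_neg.mp hdB⟩
  rcases sq_eq_sq_iff_eq_or_eq_neg.mp hcA with h1 | h1 <;> omega

/-- The sign of `d` in `4 p = c ^ 2 + 27 d ^ 2` is pinned down by a congruence for `9 d`. -/
theorem four_mul_prime_eq_sq_add_sign_unique {p : ℕ} (hp : p.Prime) (hp3 : 3 < p) {A B D : ℤ}
    (h : 4 * (p : ℤ) = A ^ 2 + 27 * B ^ 2) (hD : D = B ∨ D = -B)
    (hmod : ((9 * D : ℤ) : ZMod p) = ((9 * B : ℤ) : ZMod p)) : D = B := by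
  rcases hD with hD | rfl
  · exact hD
  have hdvd : (p : ℤ) ∣ 18 * B := by
    have := (ZMod.intCast_eq_intCast_iff_dvd_sub _ _ p).mp hmod
    convert this using 1
    ring
  have hpB : (p : ℤ) ∣ B := by
    rcases (Nat.prime_iff_prime_int.mp hp).dvd_or_dvd hdvd with h1 | h1
    · exfalso
      have h18 : p ∣ 2 * 3 ^ 2 := by exact_mod_cast h1
      rcases (hp.dvd_mul).mp h18 with h2 | h2
      · exact absurd (Nat.le_of_dvd two_pos h2) (by omega)
      · exact absurd (Nat.le_of_dvd three_pos (hp.dvd_of_dvd_pow h2)) (by omega)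
    · exact h1
  obtain ⟨k, rfl⟩ := hpB
  have hp3' : (3 : ℤ) < p := by exact_mod_cast hp3
  have hk : k = 0 := by
    by_contra hne
    have hk1 : 1 ≤ k ^ 2 := Int.add_one_le_of_lt (a := 0) (by positivity)
    nlinarith [sq_nonneg A, mul_le_mul_of_nonneg_left hk1 (sq_nonneg (p : ℤ))]
  simp [hk]

open Polynomial in
/-- For a prime `p ≡ 1 mod 3`, the cubic Jacobi sum yields `4 p = A ^ 2 + 27 B ^ 2` with
`A ≡ 1 mod 3` and a sign of `B` normalized modulo `p`, and `A`, `B` determine the number of zeros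
of `x₁³ + x₂³ + g ^ e x₃³`. -/
theorem exists_card_diagonal_cubic_eq {p : ℕ} [Fact p.Prime] (hp3 : p % 3 = 1)
    {g : (ZMod p)ˣ} (hg : ∀ x : (ZMod p)ˣ, x ∈ Subgroup.zpowers g) :
    ∃ A B : ℤ, 4 * (p : ℤ) = A ^ 2 + 27 * B ^ 2 ∧ A % 3 = 1 ∧
      ((9 * B : ℤ) : ZMod p) =
        (2 * (g : ZMod p) ^ ((p - 1) / 3) + 1) * ((A : ℤ) : ZMod p) ∧
      ∀ e : ℕ, ¬ 3 ∣ e →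
        2 * (Nat.card {x : ZMod p × ZMod p × ZMod p //
          x.1 ^ 3 + x.2.1 ^ 3 + (g : ZMod p) ^ e * x.2.2 ^ 3 = 0} : ℤ) =
        2 * (p : ℤ) ^ 2 + (p - 1) * (-A - 9 * (-1) ^ (e % 3) * B) := by
  have hcard : Fintype.card (ZMod p) = p := ZMod.card p
  have hp2 := (Fact.out : p.Prime).two_le
  have h3 : 3 ∣ Fintype.card (ZMod p) - 1 := by omega
  have sq_add {K : Type} [CommRing K] [IsDomain K] {μ : K} (hμ : IsPrimitiveRoot μ 3) :
      μ ^ 2 + μ + 1 = 0 := by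
    have := hμ.geom_sum_eq_zero (by norm_num)
    simp only [Finset.sum_range_succ, Finset.sum_range_zero] at this
    linear_combination this
  obtain ⟨a, b, hab⟩ := exists_jacobiSum_eq_add_mul hg
  -- The complex cubic character and its Jacobi sum.
  obtain ⟨ω, hω⟩ : ∃ ω : ℂ, IsPrimitiveRoot ω 3 := ⟨_, Complex.isPrimitiveRoot_exp 3 (by norm_num)⟩
  have hω0 := sq_add hω
  obtain ⟨χ, hχg⟩ := exists_mulChar_apply_generator_eq hg three_ne_zero h3 hω.pow_eq_one
  have hχ0 : χ g ^ 2 + χ g + 1 = 0 := by rw [hχg, hω0]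
  have hχ3 := MulChar.cube_eq_one_of_apply_sq_add hg hχ0
  have hχ1 : χ ≠ 1 := by
    rintro rfl
    rw [MulChar.one_apply_coe] at hχg
    exact hω.ne_one (by norm_num) hχg.symm
  have hinv : χ⁻¹ = χ ^ 2 := by rw [inv_eq_iff_mul_eq_one, ← pow_succ', hχ3]
  have hχχ : χ * χ ≠ 1 := by rw [← pow_two, ← hinv]; exact inv_ne_one.mpr hχ1
  have hJ : jacobiSum χ χ = a + b * ω := hab ℂ ω hω0 χ hχg
  have hJ' : jacobiSum χ⁻¹ χ⁻¹ = a + b * ω ^ 2 :=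
    hab ℂ (ω ^ 2) (by linear_combination (ω ^ 2 - ω + 1) * hω0) χ⁻¹
      (by rw [hinv, MulChar.pow_apply_coe, hχg])
  have hnorm : (p : ℤ) = a ^ 2 - a * b + b ^ 2 := by
    have h := jacobiSum_mul_jacobiSum_inv (F := ZMod p) (F' := ℂ)
      (by rw [ringChar.eq_zero, ZMod.ringChar_zmod_n]; omega) hχ1 hχ1 hχχ
    rw [hJ, hJ', hcard] at h
    have : ((p : ℤ) : ℂ) = ((a ^ 2 - a * b + b ^ 2 : ℤ) : ℂ) := by
      push_cast
      linear_combination -h + (a * b + b ^ 2 * (ω - 1) : ℂ) * hω0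
    exact_mod_cast this
  obtain ⟨s, t, ha, hb⟩ : ∃ s t : ℤ, a = -1 + 3 * t ∧ b = 3 * (t - s) := by
    obtain ⟨z, hz, hzJ⟩ := exists_jacobiSum_eq_neg_one_add (by norm_num) hχ3 hχ3 h3 hω
    rw [Algebra.adjoin_singleton_eq_range_aeval] at hz
    obtain ⟨P, rfl⟩ := hz
    obtain ⟨s, t, hst⟩ := exists_aeval_eq_add_mul_of_sq_add_self_add_one P
    have hst := hst ℂ ω hω0
    have h0 : ((a + 1 - 3 * t : ℤ) : ℂ) + ((b - 3 * (t - s) : ℤ) : ℂ) * ω = 0 := by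
      rw [hJ, show (aeval ω).toRingHom P = aeval ω P from rfl, hst] at hzJ
      push_cast
      linear_combination hzJ + (s + t * ω - 3 * t : ℂ) * hω0
    have := int_eq_zero_of_add_mul_eq_zero hω0 h0
    exact ⟨s, t, by linarith [this.1], by linarith [this.2]⟩
  -- The same character with values in `ZMod p`.
  have hw := isPrimitiveRoot_three_of_generator hg h3
  rw [hcard] at hw
  set w : ZMod p := (g : ZMod p) ^ ((p - 1) / 3) with hw_def
  have hw0 := sq_add hw
  have hmod : (a : ZMod p) + b * w = 0 := by
    obtain ⟨φ, hφ⟩ := exists_mulChar_apply_generator_eq hg three_ne_zero h3 hw.pow_eq_one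
    rw [← hab (ZMod p) w hw0 φ hφ, jacobiSum]
    rw [← sum_pow_mul_one_sub_pow_eq_zero (F := ZMod p) (k := (p - 1) / 3) (by omega)]
    have hφx (x : ZMod p) : φ x = x ^ ((p - 1) / 3) := by
      rcases eq_or_ne x 0 with rfl | hx
      · rw [φ.map_zero, zero_pow (by omega)]
      · obtain ⟨n, rfl⟩ := exists_pow_eq_of_forall_mem_zpowers hg hx
        rw [map_pow, hφ, hw_def, ← pow_mul, ← pow_mul, mul_comm]
    simp only [hφx]
  refine ⟨2 * a - b, t - s, ?_, by omega, ?_, fun e he ↦ ?_⟩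
  · rw [hnorm, hb]
    ring
  · have hb' : (b : ZMod p) = 3 * (t - s) := by rw [hb]; push_cast; ring
    push_cast
    linear_combination (-2 * (2 * w + 1)) * hmod + 4 * b * hw0 - 3 * hb'
  · have hy : (g : ZMod p) ^ e ≠ 0 := pow_ne_zero _ g.ne_zero
    have h := card_diagonal_cubic_eq hg h3 hχ0 hχ1 hy
    rw [hJ, hJ', map_pow, hχg, hcard] at h
    have hωe : ω ^ e = ω ^ (e % 3) := by
      conv_lhs => rw [← Nat.div_add_mod e 3, pow_add, pow_mul, hω.pow_eq_one, one_pow, one_mul]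
    have hlt := Nat.mod_lt e three_pos
    have h0 : e % 3 ≠ 0 := fun h ↦ he (Nat.dvd_of_mod_eq_zero h)
    rw [hωe] at h
    have hb' : (b : ℂ) = 3 * (t - s) := by rw [hb]; push_cast; ring
    rw [← Int.cast_inj (α := ℂ)]
    push_cast
    rw [h]
    have hω3 := hω.pow_eq_one
    have hω4 : ω ^ 4 = ω := by linear_combination ω * hω3
    interval_cases e % 3
    · exact absurd rfl h0
    · linear_combination (p - 1 : ℂ) * (2 * a * hω0 + 4 * b * hω3 + 3 * hb')
    · linear_combination (p - 1 : ℂ) * (2 * a * (hω4 + hω0) +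
        2 * b * ((ω ^ 2 + ω) * hω3 + hω0) - 3 * hb')


/-- Let `p ≡ 1 (mod 3)` be a prime and `y ∈ F_p*` non-cubic with `y = g^e`.
Then the number `T₃(y)` of zeros of `x₁³ + x₂³ + y·x₃³ = 0` over `F_p` equals
`p² + (1/2)(p-1)(-c - 9δ_y(p)d)`, where
`δ_y(p) = (-1)^{⟨e⟩₃}·sgn(Im(r₁+3√3·r₂·i)) = (-1)^{⟨e⟩₃}·sgn(r₂)`. -/
theorem T3_formula_prime_field
    (p : ℕ) [Fact p.Prime] (hp3 : p % 3 = 1)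
    (g : (ZMod p)ˣ) (hg : ∀ x : (ZMod p)ˣ, x ∈ Subgroup.zpowers g)
    (c d : ℤ) (h4p : 4 * (p : ℤ) = c ^ 2 + 27 * d ^ 2) (hc3 : c % 3 = 1)
    (hd : 0 ≤ d) (hcp : IsCoprime c (p : ℤ))
    (r1 r2 : ℤ) (hr4 : 4 * (p : ℤ) = r1 ^ 2 + 27 * r2 ^ 2) (hr3 : r1 % 3 = 1)
    (hr : ((9 * r2 : ℤ) : ZMod p)
      = (2 * ((g : ZMod p)) ^ ((p - 1) / 3) + 1) * ((r1 : ℤ) : ZMod p))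
    (y : ZMod p) (hy : ¬ ∃ x : ZMod p, x ^ 3 = y)
    (e : ℕ) (he : (g : ZMod p) ^ e = y)
    (δ : ℝ)
    (hδ : δ = (-1 : ℝ) ^ (e % 3)
      * Real.sign (((r1 : ℂ) + 3 * (Real.sqrt 3 : ℂ) * (r2 : ℂ) * Complex.I).im)) :
    (Nat.card {x : ZMod p × ZMod p × ZMod p //
        x.1 ^ 3 + x.2.1 ^ 3 + y * x.2.2 ^ 3 = 0} : ℝ)
      = (p : ℝ) ^ 2 + 1 / 2 * ((p : ℝ) - 1) * (-(c : ℝ) - 9 * δ * (d : ℝ))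
    ∧ δ = (-1 : ℝ) ^ (e % 3) * Real.sign ((r2 : ℝ)) := by
  obtain ⟨A, B, hAB, hA3, hmod, hcount⟩ := exists_card_diagonal_cubic_eq hp3 hg
  have hp : p.Prime := Fact.out
  obtain ⟨hcA, hdB⟩ := four_mul_prime_eq_sq_add_unique hp h4p hAB hc3 hA3
  obtain ⟨hrA, hrB⟩ := four_mul_prime_eq_sq_add_unique hp hr4 hAB hr3 hA3
  have hp3' : 3 < p := by
    have := hp.two_le
    omega
  have hr2 : r2 = B := by
    refine four_mul_prime_eq_sq_add_sign_unique hp hp3' hAB hrB ?_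
    rw [hr, hmod, hrA]
  have he3 : ¬ 3 ∣ e := by
    rintro ⟨m, rfl⟩
    exact hy ⟨(g : ZMod p) ^ m, by rw [← he, ← pow_mul, mul_comm]⟩
  have hδ' : δ = (-1 : ℝ) ^ (e % 3) * Real.sign (r2 : ℝ) := by
    have him : ((r1 : ℂ) + 3 * (Real.sqrt 3 : ℂ) * (r2 : ℂ) * Complex.I).im =
        (3 * Real.sqrt 3) * r2 := by
      simp
    have hpos : (0 : ℝ) < 3 * Real.sqrt 3 := by positivity
    rw [hδ, him]
    rcases lt_trichotomy (r2 : ℝ) 0 with h | h | h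
    · rw [Real.sign_of_neg h, Real.sign_of_neg (mul_neg_of_pos_of_neg hpos h)]
    · rw [h, mul_zero]
    · rw [Real.sign_of_pos h, Real.sign_of_pos (mul_pos hpos h)]
  refine ⟨?_, hδ'⟩
  have hsign : Real.sign (r2 : ℝ) * d = B := by
    have hd' : (0 : ℝ) ≤ d := by exact_mod_cast hd
    rw [hr2]
    rcases hdB with h | h
    · rw [← h]
      rcases hd'.eq_or_lt with h0 | h0
      · rw [← h0, mul_zero]
      · rw [Real.sign_of_pos h0, one_mul]
    · have hB : B = -d := by omega
      rw [hB]
      push_cast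
      rw [Real.sign_neg]
      rcases hd'.eq_or_lt with h0 | h0
      · rw [← h0]
        simp
      · rw [Real.sign_of_pos h0, neg_one_mul]
  have h := congrArg (Int.cast (R := ℝ)) (hcount e he3)
  push_cast at h
  rw [he] at h
  rw [hδ', hcA]
  linear_combination h / 2 + 9 / 2 * (p - 1 : ℝ) * (-1) ^ (e % 3) * hsign
end

section
/- One has G(χ,ψ)³ + G(χ̄,ψ)³ = c·q, where c is the integer uniquely determined by: 4q = c² + 27d² for some integer d, c ≡ 1 (mod 3), and gcd(c,p) = 1 whenever p ≡ 1 (mod 3). -/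
theorem sq_eq_sq_of_four_mul_prime_pow_eq {p : ℕ} (hp : p.Prime) (hp2 : p ≠ 2) {k : ℕ}
    (hk : 0 < k) {a b c d : ℤ}
    (h1 : 4 * (p ^ k : ℤ) = a ^ 2 + 27 * b ^ 2) (h2 : 4 * (p ^ k : ℤ) = c ^ 2 + 27 * d ^ 2)
    (ha : ¬ (p : ℤ) ∣ a) (hc : ¬ (p : ℤ) ∣ c) : c ^ 2 = a ^ 2 := by
  have hpi : Prime (p : ℤ) := Nat.prime_iff_prime_int.mp hp
  have hq0 : (0 : ℤ) < p ^ k := pow_pos (by exact_mod_cast hp.pos) k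
  have hpq : (p : ℤ) ∣ p ^ k := dvd_pow_self _ hk.ne'
  have key : ∀ e : ℤ, 4 * (p ^ k : ℤ) = c ^ 2 + 27 * e ^ 2 → (p ^ k : ℤ) ∣ c * b - a * e →
      c ^ 2 = a ^ 2 := by
    rintro e he ⟨n, hn⟩
    have h3 : (c * a + 27 * e * b) ^ 2 + 27 * (c * b - a * e) ^ 2 = 16 * (p ^ k : ℤ) ^ 2 := by
      linear_combination (-a ^ 2 - 27 * b ^ 2) * he - 4 * (p ^ k : ℤ) * h1
    rw [hn] at h3
    have hn0 : n = 0 := by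
      by_contra hne
      have : 1 ≤ n ^ 2 := by have := sq_pos_of_ne_zero hne; omega
      nlinarith [sq_nonneg (c * a + 27 * e * b), pow_pos hq0 2]
    rw [hn0, mul_zero] at hn
    have h4 : (4 * (p ^ k : ℤ)) * (c ^ 2 - a ^ 2) = 0 := by
      linear_combination c ^ 2 * h1 - a ^ 2 * he + 27 * (c * b + a * e) * hn
    rcases mul_eq_zero.mp h4 with h | h <;> linarith
  have hprod : (p ^ k : ℤ) ∣ (c * b - a * d) * (c * b + a * d) :=
    ⟨4 * (b ^ 2 - d ^ 2), by linear_combination -b ^ 2 * h2 + d ^ 2 * h1⟩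
  have hb : ¬ (p : ℤ) ∣ b := fun hb => ha <| hpi.dvd_of_dvd_pow (n := 2) <| by
    have : a ^ 2 = 4 * p ^ k - 27 * b ^ 2 := by linarith
    rw [this]
    exact dvd_sub (hpq.mul_left _) ((hb.pow two_ne_zero).mul_left _)
  have h2' : ¬ (p : ℤ) ∣ 2 := fun h => hp2 <| (Nat.prime_dvd_prime_iff_eq hp Nat.prime_two).mp
    (by exact_mod_cast h)
  by_cases hd : (p : ℤ) ∣ c * b - a * d
  · have : ¬ (p : ℤ) ∣ c * b + a * d := fun h => by
      have h5 := dvd_add hd h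
      rw [show c * b - a * d + (c * b + a * d) = 2 * (c * b) by ring] at h5
      rcases hpi.dvd_or_dvd h5 with h | h
      · exact h2' h
      · exact (hpi.dvd_or_dvd h).elim hc hb
    have := hpi.pow_dvd_of_dvd_mul_right k this hprod
    exact key d h2 this
  · have := hpi.pow_dvd_of_dvd_mul_left k hd hprod
    exact key (-d) (by linarith) (by rwa [mul_neg, sub_neg_eq_add])

theorem dvd_of_dvd_sq_add_twentySeven_mul_sq {p : ℕ} (hp : p.Prime) (hp2 : p ≠ 2)
    (hp3 : p % 3 = 2) {c d : ℤ} (h : (p : ℤ) ∣ c ^ 2 + 27 * d ^ 2) : (p : ℤ) ∣ d := by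
  have := Fact.mk hp
  by_contra hd
  rw [← ZMod.intCast_zmod_eq_zero_iff_dvd] at h hd
  push_cast at h
  have h2 : (2 : ZMod p) ≠ 0 := fun h0 => hp2 <| (Nat.prime_dvd_prime_iff_eq hp Nat.prime_two).mp
    ((ZMod.natCast_eq_zero_iff 2 p).mp (by exact_mod_cast h0))
  have h3 : (3 : ZMod p) ≠ 0 := fun h0 => by
    have := (Nat.prime_dvd_prime_iff_eq hp Nat.prime_three).mp
      ((ZMod.natCast_eq_zero_iff 3 p).mp (by exact_mod_cast h0))
    omega
  obtain ⟨t, ht⟩ : ∃ t : ZMod p, t ^ 2 + t + 1 = 0 := by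
    refine ⟨(-1 + c / (3 * d)) / 2, ?_⟩
    field_simp
    linear_combination h
  have ht3 : t ^ 3 = 1 := by linear_combination (t - 1) * ht
  have ht0 : t ≠ 0 := by rintro rfl; simp at ht
  have ht1 : t = 1 := by
    have h1 := ZMod.pow_card t
    have h2 : t ^ p = t ^ (3 * (p / 3) + 2) := congrArg (t ^ ·) (by omega)
    rw [h2, pow_add, pow_mul, ht3, one_pow, one_mul] at h1
    have : t * (t - 1) = 0 := by linear_combination h1
    exact sub_eq_zero.mp ((mul_eq_zero.mp this).resolve_left ht0)
  rw [ht1] at ht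
  apply h3; linear_combination ht

theorem sq_eq_four_mul_prime_pow {p : ℕ} (hp : p.Prime) (hp3 : p % 3 = 2) (k : ℕ) : ∀ {c d : ℤ},
    p ^ k % 3 = 1 → 4 * (p ^ k : ℤ) = c ^ 2 + 27 * d ^ 2 → c ^ 2 = 4 * p ^ k := by
  have hpi : Prime (p : ℤ) := Nat.prime_iff_prime_int.mp hp
  induction k using Nat.twoStepInduction with
  | zero =>
    intro c d _ h
    have : d = 0 := by
      by_contra hne
      have := sq_pos_of_ne_zero hne
      nlinarith [sq_nonneg c]
    subst this; linarith
  | one => intro c d h; rw [pow_one] at h; omega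
  | more k ih _ =>
    intro c d hmod h
    have hdvd : (p : ℤ) ∣ d ∧ (p : ℤ) ∣ c := by
      by_cases hp2 : p = 2
      · subst hp2
        have h8 : (8 : ℤ) ∣ c ^ 2 + 27 * d ^ 2 := ⟨2 * 2 ^ k, by rw [← h]; push_cast; ring⟩
        have hc : c % 8 = 0 ∨ c % 8 = 1 ∨ c % 8 = 2 ∨ c % 8 = 3 ∨ c % 8 = 4 ∨ c % 8 = 5 ∨
          c % 8 = 6 ∨ c % 8 = 7 := by omega
        have hd : d % 8 = 0 ∨ d % 8 = 1 ∨ d % 8 = 2 ∨ d % 8 = 3 ∨ d % 8 = 4 ∨ d % 8 = 5 ∨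
          d % 8 = 6 ∨ d % 8 = 7 := by omega
        have h8' := Int.emod_eq_zero_of_dvd h8
        rw [Int.add_emod, Int.mul_emod, pow_two, pow_two, Int.mul_emod c, Int.mul_emod d] at h8'
        push_cast
        rcases hc with hc | hc | hc | hc | hc | hc | hc | hc <;>
        rcases hd with hd | hd | hd | hd | hd | hd | hd | hd <;>
        simp [hc, hd] at h8' <;> omega
      · have hpq : (p : ℤ) ∣ c ^ 2 + 27 * d ^ 2 := h ▸ ((dvd_pow_self _ (by omega)).mul_left _)
        have hd := dvd_of_dvd_sq_add_twentySeven_mul_sq hp hp2 hp3 hpq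
        exact ⟨hd, hpi.dvd_of_dvd_pow ((dvd_add_left ((hd.pow two_ne_zero).mul_left _)).mp hpq)⟩
    obtain ⟨⟨d, rfl⟩, c, rfl⟩ := hdvd
    have hp0 : (p : ℤ) ^ 2 ≠ 0 := pow_ne_zero _ hpi.ne_zero
    have hmod' : p ^ k % 3 = 1 := by
      rw [pow_add, Nat.mul_mod, Nat.pow_mod p 2, hp3] at hmod
      omega
    have := @ih c d hmod' (mul_left_cancel₀ hp0 (by linear_combination h))
    linear_combination (p : ℤ) ^ 2 * this

theorem not_dvd_choose_of_prime_pow_eq {p : ℕ} (hp : p.Prime) (hp3 : p % 3 = 1)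
    (k : ℕ) : ∀ m : ℕ,
    p ^ k = 3 * m + 1 → ¬ p ∣ (2 * m).choose m := by
  have := Fact.mk hp
  induction k with
  | zero => intro m h; have : m = 0 := by simpa using h
            subst this; simpa using hp.one_lt.ne'
  | succ k ih =>
    intro m h
    obtain ⟨r, hr⟩ : ∃ r, p = 3 * r + 1 := ⟨p / 3, by omega⟩
    obtain ⟨n, hn⟩ : ∃ n, p ^ k = 3 * n + 1 := by
      have : p ^ k % 3 = 1 := by rw [Nat.pow_mod, hp3]; simp
      exact ⟨p ^ k / 3, by omega⟩
    have hm : m = p * n + r := by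
      have : p ^ (k+1) = p * (3 * n + 1) := by rw [pow_succ, hn]; ring
      nlinarith
    have hr1 : m % p = r := by rw [hm, Nat.mul_add_mod, Nat.mod_eq_of_lt (by omega)]
    have hr2 : m / p = n := by
      rw [hm, Nat.mul_add_div hp.pos, Nat.div_eq_of_lt (by omega), add_zero]
    have h2 : 2 * m = p * (2 * n) + 2 * r := by rw [hm]; ring
    have hr3 : 2 * m % p = 2 * r := by rw [h2, Nat.mul_add_mod, Nat.mod_eq_of_lt (by omega)]
    have hr4 : 2 * m / p = 2 * n := by
      rw [h2, Nat.mul_add_div hp.pos, Nat.div_eq_of_lt (by omega), add_zero]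
    have hl := Choose.choose_modEq_choose_mod_mul_choose_div_nat (n := 2 * m) (k := m) (p := p)
    rw [hr1, hr2, hr3, hr4] at hl
    rw [hl.dvd_iff dvd_rfl, hp.dvd_mul, not_or]
    refine ⟨fun hd => ?_, ih n hn⟩
    have := (hp.dvd_factorial).mp (hd.trans
      ⟨_, (Nat.choose_mul_factorial_mul_factorial (by omega : r ≤ 2 * r)).symm.trans
        (mul_assoc _ _ _)⟩)
    omega

/-- The sum is `-(-1) ^ m * (2m choose m)`, which is nonzero by the theorem of Lucas. -/
theorem sum_mul_one_sub_pow_ne_zero {F : Type*} [Field F] [Fintype F] {p : ℕ} [Fact p.Prime] [CharP F p]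
    {k m : ℕ} (hm : 0 < m) (hp3 : p % 3 = 1) (hF : Fintype.card F = p ^ k) (hkm : p ^ k = 3 * m + 1) :
    ∑ x : F, (x * (1 - x)) ^ (2 * m) ≠ 0 := by
  classical
  have hs : ∀ i, i ∈ Finset.range (2 * m + 1) →
      ∑ x : F, x ^ (2 * m) * ((-x) ^ i * 1 ^ (2 * m - i) * ((2 * m).choose i : F)) =
        if i = m then -((-1) ^ m * ((2 * m).choose m : F)) else 0 := by
    intro i hi
    rw [Finset.mem_range] at hi
    have : ∀ x : F, x ^ (2 * m) * ((-x) ^ i * 1 ^ (2 * m - i) * ((2 * m).choose i : F)) =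
        ((-1) ^ i * ((2 * m).choose i : F)) * x ^ (2 * m + i) := by
      intro x; rw [neg_pow]; ring
    simp_rw [this]
    rw [← Finset.mul_sum, ← Fintype.sum_subtype_add_sum_subtype (fun x : F => x ≠ 0)]
    have h0 : ∑ x : {x : F // ¬ x ≠ 0}, (x : F) ^ (2 * m + i) = 0 :=
      Finset.sum_eq_zero fun x _ => by
        rw [not_not.mp x.2, zero_pow (by omega)]
    have h1 : ∑ x : {x : F // x ≠ 0}, (x : F) ^ (2 * m + i) =
        ∑ x : Fˣ, ((x : F) ^ (2 * m + i)) :=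
      (Fintype.sum_equiv unitsEquivNeZero _ _ (fun x => rfl)).symm
    rw [h0, h1, add_zero, FiniteField.sum_pow_units, hF, hkm]
    have : (3 * m + 1 - 1 ∣ 2 * m + i) ↔ i = m := by
      constructor
      · rintro ⟨n, hn⟩
        rw [Nat.add_sub_cancel] at hn
        have : n = 1 := by
          have h2 : n < 2 := by by_contra h; nlinarith
          have h3 : n ≠ 0 := by rintro rfl; omega
          omega
        subst this; omega
      · rintro rfl; exact ⟨1, by omega⟩
    simp only [this]
    split_ifs with h
    · rw [h]; ring
    · ring
  have : ∑ x : F, (x * (1 - x)) ^ (2 * m) = -((-1) ^ m * ((2 * m).choose m : F)) := by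
    have : ∀ x : F, (x * (1 - x)) ^ (2 * m) = ∑ i ∈ Finset.range (2 * m + 1),
        x ^ (2 * m) * ((-x) ^ i * 1 ^ (2 * m - i) * ((2 * m).choose i : F)) := by
      intro x
      rw [mul_pow, sub_eq_neg_add, add_pow, Finset.mul_sum]
    simp_rw [this]
    rw [Finset.sum_comm, Finset.sum_congr rfl hs, Finset.sum_ite_eq', if_pos]
    rw [Finset.mem_range]; omega
  rw [this, neg_ne_zero]
  refine mul_ne_zero (pow_ne_zero _ (neg_ne_zero.mpr one_ne_zero)) fun h => ?_
  exact not_dvd_choose_of_prime_pow_eq Fact.out hp3 k m hkm ((CharP.cast_eq_zero_iff F p _).mp h)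

theorem int_add_mul_inj {w : ℂ} (hw : w.im ≠ 0) {a b a' b' : ℤ}
    (h : (a : ℂ) + b * w = a' + b' * w) : a = a' ∧ b = b' := by
  have him := congrArg Complex.im h
  simp only [Complex.add_im, Complex.intCast_im, Complex.mul_im, Complex.intCast_re, zero_mul,
    add_zero, zero_add] at him
  have hb : b = b' := by exact_mod_cast mul_right_cancel₀ hw him
  subst hb
  exact ⟨by exact_mod_cast add_right_cancel h, rfl⟩

theorem exists_eq_int_add_mul_of_mem_adjoin {w : ℂ} (hw : w ^ 2 + w + 1 = 0) {z : ℂ}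
    (hz : z ∈ Algebra.adjoin ℤ {w}) : ∃ a b : ℤ, z = a + b * w := by
  induction hz using Algebra.adjoin_induction with
  | mem x hx => exact ⟨0, 1, by simpa using hx⟩
  | algebraMap r => exact ⟨r, 0, by simp⟩
  | add x y _ _ hx hy =>
    obtain ⟨a, b, rfl⟩ := hx
    obtain ⟨c, d, rfl⟩ := hy
    exact ⟨a + c, b + d, by push_cast; ring⟩
  | mul x y _ _ hx hy =>
    obtain ⟨a, b, rfl⟩ := hx
    obtain ⟨c, d, rfl⟩ := hy
    exact ⟨a * c - b * d, a * d + b * c - b * d, by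
      push_cast; linear_combination (b * d : ℂ) * hw⟩

/-- Powers of roots of `X² + X + 1` in two rings have the same integer coordinates. -/
theorem exists_pow_eq_int_add_mul {R S : Type*} [CommRing R] [CommRing S] {w : R} {t : S}
    (hw : w ^ 2 + w + 1 = 0) (ht : t ^ 2 + t + 1 = 0) (j : ℕ) :
    ∃ a b : ℤ, w ^ j = a + b * w ∧ t ^ j = a + b * t := by
  induction j with
  | zero => exact ⟨1, 0, by simp, by simp⟩
  | succ j ih =>
    obtain ⟨a, b, h1, h2⟩ := ih
    refine ⟨-b, a - b, ?_, ?_⟩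
    · rw [pow_succ, h1]; push_cast; linear_combination (b : R) * hw
    · rw [pow_succ, h2]; push_cast; linear_combination (b : S) * ht

/-- Reduction of a cubic Jacobi sum along the place where `χ` becomes `x ↦ x ^ (2m)`. -/
theorem sum_mul_one_sub_pow_eq {F : Type*} [Field F] [Fintype F] {m : ℕ} (hm : 0 < m)
    (hF : Fintype.card F = 3 * m + 1) {g : Fˣ} (hg : ∀ x : Fˣ, x ∈ Subgroup.zpowers g)
    {χ : MulChar F ℂ} {w : ℂ} (hw : w ^ 2 + w + 1 = 0) (hw' : w.im ≠ 0) (hχ : χ (g : F) = w)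
    {a b : ℤ} (hJ : jacobiSum χ χ = a + b * w) :
    ∑ x : F, (x * (1 - x)) ^ (2 * m) = a + b * (g : F) ^ (2 * m) := by
  classical
  have hord : orderOf g = 3 * m := by
    rw [orderOf_eq_card_of_forall_mem_zpowers hg, Nat.card_eq_fintype_card, Fintype.card_units, hF,
      Nat.add_sub_cancel]
  have ht : ((g : F) ^ (2 * m)) ^ 2 + (g : F) ^ (2 * m) + 1 = 0 := by
    have h3 : ((g : F) ^ (2 * m)) ^ 3 = 1 := by
      rw [← pow_mul, show 2 * m * 3 = 3 * m * 2 by ring, pow_mul, ← hord,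
        ← Units.val_pow_eq_pow_val, pow_orderOf_eq_one, Units.val_one, one_pow]
    have h1 : (g : F) ^ (2 * m) ≠ 1 := by
      rw [← Units.val_pow_eq_pow_val, Ne, Units.val_eq_one]
      exact pow_ne_one_of_lt_orderOf (by omega) (by omega)
    have : ((g : F) ^ (2 * m) - 1) * (((g : F) ^ (2 * m)) ^ 2 + (g : F) ^ (2 * m) + 1) = 0 := by
      linear_combination h3
    exact (mul_eq_zero.mp this).resolve_left (sub_ne_zero.mpr h1)
  have hpt : ∀ y : F, ∃ a b : ℤ, χ y = a + b * w ∧ y ^ (2 * m) = a + b * (g : F) ^ (2 * m) := by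
    intro y
    by_cases hy : y = 0
    · refine ⟨0, 0, ?_, ?_⟩
      · rw [hy, MulChar.map_zero]; simp
      · rw [hy, zero_pow (by omega)]; simp
    · obtain ⟨j, hj⟩ := (mem_powers_iff_mem_zpowers).mpr (hg (Units.mk0 y hy))
      have hj' : y = (g : F) ^ j := by
        rw [← Units.val_pow_eq_pow_val, ← Units.val_mk0 hy]; exact congrArg _ hj.symm
      obtain ⟨a, b, h1, h2⟩ := exists_pow_eq_int_add_mul hw ht j
      exact ⟨a, b, by rw [hj', map_pow, hχ, h1], by rw [hj', ← h2]; ring⟩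
  choose A B hA hB using hpt
  have hJ' : jacobiSum χ χ =
      (∑ x : F, A (x * (1 - x)) : ℤ) + (∑ x : F, B (x * (1 - x)) : ℤ) * w := by
    have : ∀ x : F, χ x * χ (1 - x) = A (x * (1 - x)) + B (x * (1 - x)) * w := fun x => by
      rw [← map_mul, hA]
    simp_rw [jacobiSum, this]
    push_cast
    rw [Finset.sum_add_distrib, Finset.sum_mul]
  obtain ⟨rfl, rfl⟩ := int_add_mul_inj hw' (hJ.symm.trans hJ')
  rw [Finset.sum_congr rfl fun x _ => hB (x * (1 - x))]
  push_cast
  rw [Finset.sum_add_distrib, Finset.sum_mul]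

theorem isPrimitive_of_eq_exp_trace {p : ℕ} [Fact p.Prime] {F : Type*} [Field F] [Fintype F]
    [Algebra (ZMod p) F] {ψ : AddChar F ℂ}
    (hψ : ∀ x : F, ψ x = Complex.exp (2 * (Real.pi : ℂ) * Complex.I
      * ((Algebra.trace (ZMod p) F x).val : ℂ) / (p : ℂ))) : ψ.IsPrimitive := by
  apply AddChar.IsPrimitive.of_ne_one
  obtain ⟨x, hx⟩ := Algebra.trace_surjective (ZMod p) F 1
  refine AddChar.ne_one_iff.mpr ⟨x, fun h => ?_⟩
  have hp : p.Prime := Fact.out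
  have : Fact (1 < p) := ⟨hp.one_lt⟩
  rw [hψ, hx, ZMod.val_one, Nat.cast_one, mul_one] at h
  exact hp.ne_one ((Complex.isPrimitiveRoot_exp p hp.ne_zero).unique
    (IsPrimitiveRoot.one_right_iff.mpr h))

theorem jacobiSum_add_conj_eq
    {p k q : ℕ} [Fact p.Prime] (hk : 0 < k) (hq : q = p ^ k) (hq3 : q % 3 = 1)
    {F : Type} [Field F] [Fintype F] [CharP F p] (hF : Fintype.card F = q)
    {g : Fˣ} (hg : ∀ x : Fˣ, x ∈ Subgroup.zpowers g)
    {χ : MulChar F ℂ} (hχ3 : orderOf χ = 3) {w : ℂ} (hw : w ^ 2 + w + 1 = 0) (hw' : w.im ≠ 0)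
    (hwc : starRingEnd ℂ w = -1 - w)
    (hχ : χ (g : F) = w)
    {c d : ℤ} (h4q : 4 * (q : ℤ) = c ^ 2 + 27 * d ^ 2) (hc3 : c % 3 = 1)
    (hcp : p % 3 = 1 → IsCoprime c (p : ℤ)) :
    jacobiSum χ χ + starRingEnd ℂ (jacobiSum χ χ) = c := by
  have hp : p.Prime := Fact.out
  have hw3 : w ^ 3 = 1 := by linear_combination (w - 1) * hw
  have hprim : IsPrimitiveRoot w 3 := by
    refine orderOf_eq_prime (p := 3) hw3 ?_ ▸ IsPrimitiveRoot.orderOf w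
    rintro rfl; simp at hw'
  have hχ3' : χ ^ 3 = 1 := hχ3 ▸ pow_orderOf_eq_one χ
  have hne : ∀ n, 0 < n → n < 3 → χ ^ n ≠ 1 := fun n h0 h3 =>
    pow_ne_one_of_lt_orderOf h0.ne' (hχ3 ▸ h3)
  have hconj : starRingEnd ℂ (jacobiSum χ χ) = jacobiSum χ⁻¹ χ⁻¹ := by
    rw [← jacobiSum_ringHomComp, ← MulChar.star_eq_inv]; rfl
  have hnorm : jacobiSum χ χ * starRingEnd ℂ (jacobiSum χ χ) = q := by
    rw [hconj, jacobiSum_mul_jacobiSum_inv, hF]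
    · rw [ringChar.eq F p, ringChar.eq_zero]; exact hp.ne_zero.symm
    · simpa using hne 1
    · simpa using hne 1
    · rw [← pow_two]; exact hne 2 (by norm_num) (by norm_num)
  obtain ⟨z, hz, hJ⟩ := exists_jacobiSum_eq_neg_one_add (n := 3) (by norm_num) hχ3' hχ3'
    (by omega) hprim
  obtain ⟨u, v, rfl⟩ := exists_eq_int_add_mul_of_mem_adjoin hw hz
  have hJ' : jacobiSum χ χ = (3 * v - 1 : ℤ) + (3 * v - 3 * u : ℤ) * w := by
    rw [hJ]; push_cast; linear_combination (u + v * w - 3 * v : ℂ) * hw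
  have hJc : starRingEnd ℂ (jacobiSum χ χ) =
      (3 * v - 1 : ℤ) + (3 * v - 3 * u : ℤ) * (-1 - w) := by
    rw [hJ', map_add, map_mul, hwc, map_intCast, map_intCast]
  have hsum : jacobiSum χ χ + starRingEnd ℂ (jacobiSum χ χ) = (3 * v + 3 * u - 2 : ℤ) := by
    rw [hJc, hJ']; push_cast; ring
  have h4A : 4 * (q : ℤ) = (3 * v + 3 * u - 2) ^ 2 + 27 * (v - u) ^ 2 := by
    have : (4 * q : ℂ) = (3 * v + 3 * u - 2) ^ 2 + 27 * (v - u) ^ 2 := by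
      rw [← hnorm, hJc, hJ']; push_cast
      linear_combination (-36 * (v - u) ^ 2 : ℂ) * hw
    exact_mod_cast this
  have hpq : (p : ℤ) ∣ q := by rw [hq]; push_cast; exact dvd_pow_self _ hk.ne'
  have hsq : c ^ 2 = (3 * v + 3 * u - 2) ^ 2 := by
    have hpmod : p % 3 ≠ 0 := fun h => by
      have : 3 ∣ q := hq ▸ (Nat.dvd_of_mod_eq_zero h).trans (dvd_pow_self _ hk.ne')
      omega
    have : p % 3 = 1 ∨ p % 3 = 2 := by omega
    rcases this with hp3 | hp3
    · have hp2 : p ≠ 2 := by rintro rfl; omega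
      have hpi : Prime (p : ℤ) := Nat.prime_iff_prime_int.mp hp
      have hqz : (q : ℤ) = (p : ℤ) ^ k := by rw [hq]; push_cast; rfl
      refine sq_eq_sq_of_four_mul_prime_pow_eq hp hp2 hk (hqz ▸ h4A) (hqz ▸ h4q) (fun hA => ?_)
        (fun hc => ?_)
      · have hbad : ∀ n : ℕ, n.Prime → n ≠ p → ¬ (p : ℤ) ∣ n := fun n hn hnp h =>
          hnp.symm ((Nat.prime_dvd_prime_iff_eq hp hn).mp (by exact_mod_cast h))
        have h2 : ¬ (p : ℤ) ∣ 2 := by exact_mod_cast hbad 2 Nat.prime_two hp2.symm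
        have h3 : ¬ (p : ℤ) ∣ 3 := by
          exact_mod_cast hbad 3 Nat.prime_three (by rintro rfl; omega)
        have hB : (p : ℤ) ∣ v - u := by
          have h27 : (p : ℤ) ∣ 3 ^ 3 * (v - u) ^ 2 := by
            rw [show 3 ^ 3 * (v - u) ^ 2 = 4 * (q : ℤ) - (3 * v + 3 * u - 2) ^ 2 by
              rw [h4A]; ring]
            exact dvd_sub (hpq.mul_left _) (hA.pow two_ne_zero)
          exact hpi.dvd_of_dvd_pow ((hpi.dvd_or_dvd h27).resolve_left
            fun h => h3 (hpi.dvd_of_dvd_pow h))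
        have ha : (p : ℤ) ∣ 3 * v - 1 := by
          refine (hpi.dvd_or_dvd ?_).resolve_left h2
          rw [show 2 * (3 * v - 1) = (3 * v + 3 * u - 2) + 3 * (v - u) by ring]
          exact dvd_add hA (hB.mul_left _)
        have hb : (p : ℤ) ∣ 3 * v - 3 * u := by rw [← mul_sub]; exact hB.mul_left _
        obtain ⟨m, hm⟩ : ∃ m, q = 3 * m + 1 := ⟨q / 3, by omega⟩
        have hm0 : 0 < m := by
          have : 1 < q := hq ▸ Nat.one_lt_pow hk.ne' hp.one_lt
          omega
        refine sum_mul_one_sub_pow_ne_zero (F := F) hm0 hp3 (hF.trans hq) (hq ▸ hm) ?_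
        rw [sum_mul_one_sub_pow_eq hm0 (hF.trans hm) hg hw hw' hχ hJ',
          (CharP.intCast_eq_zero_iff F p _).mpr ha, (CharP.intCast_eq_zero_iff F p _).mpr hb]
        ring
      · exact hpi.not_isUnit ((hcp hp3).isUnit_of_dvd' hc dvd_rfl)
    · have hq3' := hq ▸ hq3
      have hqz : (q : ℤ) = (p : ℤ) ^ k := by rw [hq]; push_cast; rfl
      rw [hqz] at h4q h4A
      rw [sq_eq_four_mul_prime_pow hp hp3 k hq3' h4q, sq_eq_four_mul_prime_pow hp hp3 k hq3' h4A]
  have : c = 3 * v + 3 * u - 2 := by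
    rcases sq_eq_sq_iff_eq_or_eq_neg.mp hsq with h | h <;> omega
  rw [hsum, this]


/-- `G(χ,ψ)³ + G(χ̄,ψ)³ = c·q`, where `χ` is the cubic character with
`χ(g) = (-1+√3·i)/2`, `ψ` is the canonical additive character of `F_q`, and
`c` is determined by `4q = c²+27d²`, `c ≡ 1 (mod 3)`, `gcd(c,p)=1` if `p ≡ 1 (mod 3)`. -/
theorem gaussSum_cube_add_conj_cube
    (p k q : ℕ) [Fact p.Prime] (hk : 0 < k) (hq : q = p ^ k) (hq3 : q % 3 = 1)
    (F : Type) [Field F] [Fintype F] [Algebra (ZMod p) F] (hF : Fintype.card F = q)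
    (g : Fˣ) (hg : ∀ x : Fˣ, x ∈ Subgroup.zpowers g)
    (χ : MulChar F ℂ) (hχ : χ (g : F) = (-1 + (Real.sqrt 3 : ℂ) * Complex.I) / 2)
    (ψ : AddChar F ℂ)
    (hψ : ∀ x : F, ψ x = Complex.exp (2 * (Real.pi : ℂ) * Complex.I
      * ((Algebra.trace (ZMod p) F x).val : ℂ) / (p : ℂ)))
    (c d : ℤ) (h4q : 4 * (q : ℤ) = c ^ 2 + 27 * d ^ 2) (hc3 : c % 3 = 1)
    (hcp : p % 3 = 1 → IsCoprime c (p : ℤ)) :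
    gaussSum χ ψ ^ 3 + gaussSum (χ.ringHomComp (starRingEnd ℂ)) ψ ^ 3
      = (c : ℂ) * (q : ℂ) := by
  set w : ℂ := (-1 + (Real.sqrt 3 : ℂ) * Complex.I) / 2 with hwdef
  have hs : (Real.sqrt 3 : ℂ) ^ 2 = 3 := by
    exact_mod_cast congrArg ((↑) : ℝ → ℂ) (Real.sq_sqrt (by norm_num : (0 : ℝ) ≤ 3))
  have hw : w ^ 2 + w + 1 = 0 := by
    rw [hwdef]
    linear_combination (Complex.I ^ 2 / 4) * hs + (3 / 4) * Complex.I_sq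
  have hw' : w.im ≠ 0 := by simp [hwdef]
  have hwc : starRingEnd ℂ w = -1 - w := by
    rw [hwdef]
    simp only [map_div₀, map_add, map_neg, map_one, map_mul, Complex.conj_ofReal, Complex.conj_I,
      map_ofNat]
    ring
  have hw3 : w ^ 3 = 1 := by linear_combination (w - 1) * hw
  have hw1 : w ≠ 1 := fun h => hw' (by rw [h, Complex.one_im])
  have hχ3 : orderOf χ = 3 := by
    refine orderOf_eq_prime ?_ fun h => hw1 ?_
    · ext x
      obtain ⟨j, rfl⟩ := Subgroup.mem_zpowers_iff.mp (hg x)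
      have hj : (χ ^ 3).toUnitHom g = 1 := by
        ext; rw [MulChar.coe_toUnitHom, MulChar.pow_apply_coe, hχ, hw3, Units.val_one]
      rw [← MulChar.coe_toUnitHom, map_zpow, hj, one_zpow, MulChar.one_apply_coe, Units.val_one]
    · rw [← hχ, h, MulChar.one_apply_coe]
  have : CharP F p := charP_of_injective_algebraMap (algebraMap (ZMod p) F).injective p
  have hχneg : χ (-1) = 1 := by
    have h1 : χ (-1) ^ 2 = 1 := by rw [← map_pow, neg_one_sq, map_one]
    have h2 : χ (-1) ^ 3 = 1 := by
      rw [← MulChar.pow_apply' _ three_ne_zero, ← hχ3, pow_orderOf_eq_one,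
        MulChar.one_apply isUnit_one.neg]
    rwa [pow_succ, h1, one_mul] at h2
  have hψp := isPrimitive_of_eq_exp_trace hψ
  have hcube : ∀ φ : MulChar F ℂ, orderOf φ = 3 → φ (-1) = 1 →
      gaussSum φ ψ ^ 3 = q * jacobiSum φ φ := by
    intro φ hφ hφneg
    have h := gaussSum_pow_eq_prod_jacobiSum (χ := φ) (by omega) hψp
    rw [hφ, hφneg, hF] at h
    simpa using h
  have hconj : χ.ringHomComp (starRingEnd ℂ) = χ⁻¹ := MulChar.star_eq_inv χ
  rw [hcube χ hχ3 hχneg, hcube _ (by rw [hconj, orderOf_inv, hχ3])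
    (by rw [MulChar.ringHomComp_apply, hχneg, map_one]), jacobiSum_ringHomComp, ← mul_add,
    jacobiSum_add_conj_eq hk hq hq3 hF hg hχ3 hw hw' hwc hχ h4q hc3 hcp, mul_comm]
end

section
/- If k is odd (so that p ≡ 1 (mod 3)), then G(χ,ψ)³ = (p/2)^k · (r_1 + 3√3·r_2·i)^k as complex numbers. -/
open QuadraticAlgebra Finset

/-- The ring `ℤ[ω]` of Eisenstein integers, with `ω ^ 2 = -1 - ω`. -/
abbrev EisensteinInt : Type := QuadraticAlgebra ℤ (-1) (-1)

namespace EisensteinInt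

theorem norm_eq (x : EisensteinInt) : x.norm = x.re ^ 2 - x.re * x.im + x.im ^ 2 := by
  rw [norm_def]; ring

theorem norm_eq_zero {x : EisensteinInt} (h : x.norm = 0) : x = 0 := by
  rw [norm_eq] at h
  have h1 : x.im = 0 := by
    have : x.im ^ 2 = 0 := by nlinarith [sq_nonneg (2 * x.re - x.im), sq_nonneg x.im]
    exact pow_eq_zero_iff two_ne_zero |>.1 this
  have h2 : x.re = 0 := by
    rw [h1] at h
    exact pow_eq_zero_iff two_ne_zero |>.1 (by linarith)
  ext <;> simp [h1, h2]

instance : NoZeroDivisors EisensteinInt where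
  eq_zero_or_eq_zero_of_mul_eq_zero {x y} h := by
    have h' : x.norm * y.norm = 0 := by rw [← map_mul, h, QuadraticAlgebra.norm_zero]
    exact (mul_eq_zero.1 h').imp norm_eq_zero norm_eq_zero

instance : IsDomain EisensteinInt := NoZeroDivisors.to_isDomain _

theorem mul_star_eq_norm (x : EisensteinInt) : x * star x = (x.norm : EisensteinInt) := by
  rw [← algebraMap_norm_eq_mul_star]; rfl

theorem omega_sq : (ω : EisensteinInt) ^ 2 + ω + 1 = 0 := by
  ext <;> simp [sq]

theorem isPrimitiveRoot_omega : IsPrimitiveRoot (ω : EisensteinInt) 3 := by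
  have h : orderOf (ω : EisensteinInt) = 3 := by
    refine orderOf_eq_prime (by linear_combination (ω - 1) * omega_sq) fun h => ?_
    simpa using congrArg QuadraticAlgebra.im h
  exact h ▸ IsPrimitiveRoot.orderOf _

/-- The ring homomorphism from the Eisenstein integers sending `ω` to a given root of
`X ^ 2 + X + 1`. -/
def liftHom {A : Type*} [CommRing A] (u : A) (hu : u ^ 2 + u + 1 = 0) : EisensteinInt →+* A :=
  (QuadraticAlgebra.lift ⟨u, by simp; linear_combination hu⟩ : EisensteinInt →ₐ[ℤ] A).toRingHom

theorem liftHom_apply {A : Type*} [CommRing A] (u : A) (hu : u ^ 2 + u + 1 = 0)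
    (x : EisensteinInt) : liftHom u hu x = x.re + x.im * u := by
  simp [liftHom]

theorem prime_of_norm_eq {K : Type*} [Field K] (p : ℕ) [CharP K p] (hp : p ≠ 0)
    (h3 : (3 : K) ≠ 0) {π : EisensteinInt} (hπ : π.norm = p) (φ : EisensteinInt →+* K)
    (hφ : φ π = 0) : Prime π := by
  have key (x : EisensteinInt) (hx : φ x = 0) : π ∣ x := by
    obtain ⟨y, hy⟩ : ∃ y, y = x * star π := ⟨_, rfl⟩
    have h1 : φ y = 0 := by rw [hy, map_mul, hx, zero_mul]
    have h2 : φ (star y) = 0 := by rw [hy, star_mul, star_star, map_mul, hφ, zero_mul]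
    have hy1 : y = (y.re : EisensteinInt) + (y.im : EisensteinInt) * ω := by ext <;> simp
    have hd : y - star y = (y.im : EisensteinInt) * (1 + 2 * ω) := by
      ext
      · simp
      · simp; ring
    have him : (y.im : K) = 0 := by
      have h4 : (y.im : K) * φ (1 + 2 * ω) = 0 := by
        rw [← map_intCast φ, ← map_mul, ← hd, map_sub, h1, h2, sub_zero]
      refine (mul_eq_zero.1 h4).resolve_right fun h5 => h3 ?_
      have h6 : (1 + 2 * ω : EisensteinInt) ^ 2 = -3 := by
        linear_combination 4 * omega_sq
      have := congrArg φ h6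
      rw [map_pow, h5] at this
      rw [map_neg, map_ofNat] at this
      simpa using this.symm
    have hre : (y.re : K) = 0 := by
      have := h1
      rw [hy1, map_add, map_mul, map_intCast, map_intCast, him] at this
      simpa using this
    obtain ⟨a, ha⟩ := (CharP.intCast_eq_zero_iff K p _).1 hre
    obtain ⟨b, hb⟩ := (CharP.intCast_eq_zero_iff K p _).1 him
    have hs : star π ≠ 0 := by
      intro h
      have : π = 0 := by simpa using h
      rw [this, QuadraticAlgebra.norm_zero] at hπ
      exact hp (by exact_mod_cast hπ.symm)
    refine ⟨⟨a, b⟩, mul_right_cancel₀ hs ?_⟩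
    rw [← hy, mul_right_comm, mul_star_eq_norm, hπ]
    ext <;> simp [ha, hb]
  refine ⟨?_, ?_, fun a b hab => ?_⟩
  · rintro rfl
    rw [QuadraticAlgebra.norm_zero] at hπ
    exact hp (by exact_mod_cast hπ.symm)
  · exact fun hu => (hu.map φ).ne_zero hφ
  · obtain ⟨c, hc⟩ := hab
    have : φ a * φ b = 0 := by rw [← map_mul, hc, map_mul, hφ, zero_mul]
    exact (mul_eq_zero.1 this).imp (key a) (key b)

/-- A norm-one Eisenstein integer congruent to `1` modulo `3` is `1`. -/
theorem eq_one_of_norm_eq_one {u : EisensteinInt} (hu : u.norm = 1) (h3 : 3 ∣ u - 1) : u = 1 := by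
  obtain ⟨z, hz⟩ := h3
  have hre := congrArg QuadraticAlgebra.re hz
  have him := congrArg QuadraticAlgebra.im hz
  simp at hre him
  rw [norm_eq] at hu
  have hb : z.im = 0 := by
    rw [him] at hu
    by_contra hne
    have : 0 < z.im ^ 2 := by positivity
    nlinarith [sq_nonneg (2 * u.re - 3 * z.im)]
  rw [hb] at him
  have h1 : u.re = 1 := by
    rw [him] at hu
    have h2 : (u.re - 1) * (u.re + 1) = 0 := by linear_combination hu
    rcases mul_eq_zero.1 h2 with h | h <;> omega
  ext <;> simp [h1, him]

theorem three_dvd_pow_add_one {π : EisensteinInt} (h : 3 ∣ π + 1) {k : ℕ} (hk : Odd k) :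
    3 ∣ π ^ k + 1 := by
  simpa using h.trans (hk.add_dvd_pow_add_pow π 1)

/-- An Eisenstein integer `x` of norm `p ^ k` not divisible by the conjugate of a prime `π` of
norm `p` equals `π ^ k`, if `k` is odd and `x` and `π` are both `-1` modulo `3`. -/
theorem eq_pow_of_norm_eq {p k : ℕ} {x π : EisensteinInt} (hk : Odd k) (hprime : Prime π)
    (hπ : π.norm = p) (hx : x.norm = p ^ k) (hndvd : ¬ π ∣ star x)
    (hx3 : 3 ∣ x + 1) (hπ3 : 3 ∣ π + 1) : x = π ^ k := by
  have h1 : π ^ k ∣ x * star x := by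
    rw [mul_star_eq_norm, hx, ← hπ, Int.cast_pow, ← mul_star_eq_norm, mul_pow]
    exact dvd_mul_right _ _
  obtain ⟨u, rfl⟩ := hprime.pow_dvd_of_dvd_mul_right k hndvd h1
  have hp : (p : ℤ) ^ k ≠ 0 := by
    rw [← hπ, ← map_pow]
    exact fun h => pow_ne_zero k hprime.ne_zero (norm_eq_zero h)
  have hu : u.norm = 1 := by
    rw [map_mul, map_pow, hπ] at hx
    exact mul_left_cancel₀ hp (by rw [hx, mul_one])
  have h2 := three_dvd_pow_add_one hπ3 hk
  have h3 : 3 ∣ u - 1 := by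
    have h4 : u - 1 = u * (π ^ k + 1) - (π ^ k * u + 1) := by ring
    rw [h4]
    exact dvd_sub (h2.mul_left u) hx3
  rw [eq_one_of_norm_eq_one hu h3, mul_one]

end EisensteinInt

theorem not_dvd_choose_of_pow_eq {p : ℕ} [Fact p.Prime] (hp3 : p % 3 = 1) (k m : ℕ)
    (h : p ^ k = 3 * m + 1) : ¬ p ∣ (2 * m).choose m := by
  have hp : p.Prime := Fact.out
  induction k generalizing m with
  | zero =>
    obtain rfl : m = 0 := by simpa using h
    simpa using hp.one_lt.ne'
  | succ k ih =>
    obtain ⟨t, ht⟩ : ∃ t, p = 3 * t + 1 := ⟨p / 3, by omega⟩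
    obtain ⟨n, hn⟩ : ∃ n, p ^ k = 3 * n + 1 :=
      ⟨p ^ k / 3, by have : p ^ k % 3 = 1 := by simp [Nat.pow_mod, hp3]
                     omega⟩
    have hm : m = t + p * n := by
      rw [pow_succ, hn] at h
      rw [ht] at h ⊢
      nlinarith
    have hpp : 0 < p := hp.pos
    have h1 : m % p = t := by rw [hm, Nat.add_mul_mod_self_left, Nat.mod_eq_of_lt (by omega)]
    have h2 : m / p = n := by
      rw [hm, Nat.add_mul_div_left _ _ hpp, Nat.div_eq_of_lt (by omega), zero_add]
    have hm' : 2 * m = 2 * t + p * (2 * n) := by rw [hm]; ring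
    have h3 : 2 * m % p = 2 * t := by
      rw [hm', Nat.add_mul_mod_self_left, Nat.mod_eq_of_lt (by omega)]
    have h4 : 2 * m / p = 2 * n := by
      rw [hm', Nat.add_mul_div_left _ _ hpp, Nat.div_eq_of_lt (by omega), zero_add]
    have h5 := Choose.choose_modEq_choose_mod_mul_choose_div_nat (p := p) (n := 2 * m) (k := m)
    rw [h1, h2, h3, h4] at h5
    rw [h5.dvd_iff dvd_rfl, hp.dvd_mul, not_or]
    refine ⟨fun hd => ?_, ih n hn⟩
    have h6 : p ∣ (2 * t).factorial :=
      hd.trans ⟨t.factorial * (2 * t - t).factorial, by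
        rw [← mul_assoc, Nat.choose_mul_factorial_mul_factorial (by omega)]⟩
    have := hp.dvd_factorial.1 h6
    omega

namespace FiniteField

variable {F : Type*} [Field F] [Fintype F]

theorem sum_pow_eq_ite {n : ℕ} (hn : n ≠ 0) :
    ∑ x : F, x ^ n = if Fintype.card F - 1 ∣ n then -1 else 0 := by
  classical
  have h : ∑ x : F, x ^ n = ∑ x ∈ univ.filter (fun x : F => x ≠ 0), x ^ n := by
    refine (Finset.sum_subset (Finset.subset_univ _) fun x _ hx => ?_).symm
    have : x = 0 := by simpa using hx
    rw [this, zero_pow hn]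
  rw [← sum_pow_units F n, h]
  refine (Finset.sum_bij (fun (u : Fˣ) _ => (u : F)) ?_ ?_ ?_ ?_).symm
  · simp
  · intro a _ b _ h; exact Units.ext h
  · intro b hb
    exact ⟨Units.mk0 b (by simpa using hb), mem_univ _, rfl⟩
  · simp

theorem sum_pow_mul_one_sub_pow (a b : ℕ) :
    ∑ x : F, x ^ a * (1 - x) ^ b =
      ∑ i ∈ range (b + 1), (-1) ^ i * (b.choose i : F) * ∑ x : F, x ^ (a + i) := by
  simp_rw [Finset.mul_sum]
  rw [Finset.sum_comm]
  refine Finset.sum_congr rfl fun x _ => ?_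
  rw [sub_eq_neg_add, add_pow, Finset.mul_sum]
  refine Finset.sum_congr rfl fun i _ => ?_
  rw [neg_pow]; ring

theorem sum_pow_mul_one_sub_pow_eq_zero {m : ℕ} (hq : Fintype.card F = 3 * m + 1) (hm : 0 < m) :
    ∑ x : F, x ^ m * (1 - x) ^ m = 0 := by
  rw [sum_pow_mul_one_sub_pow]
  refine Finset.sum_eq_zero fun i hi => ?_
  rw [mem_range] at hi
  rw [sum_pow_lt_card_sub_one F _ (by omega), mul_zero]

theorem sum_pow_two_mul_one_sub_pow {m : ℕ} (hq : Fintype.card F = 3 * m + 1) (hm : 0 < m) :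
    ∑ x : F, x ^ (2 * m) * (1 - x) ^ (2 * m) = -((-1) ^ m * ((2 * m).choose m : F)) := by
  rw [sum_pow_mul_one_sub_pow, Finset.sum_eq_single m]
  · rw [sum_pow_eq_ite (by omega), if_pos (by rw [hq]; exact ⟨1, by omega⟩)]; ring
  · intro i hi him
    rw [mem_range] at hi
    rw [sum_pow_eq_ite (by omega), if_neg, mul_zero]
    rw [hq]
    rintro ⟨c, hc⟩
    rcases c with _ | _ | c
    · omega
    · omega
    · rw [Nat.add_sub_cancel] at hc
      nlinarith
  · intro h
    exact absurd (mem_range.2 (by omega)) h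

end FiniteField

namespace MulChar

theorem apply_ringHom_eq_pow {F R : Type*} [Field F] [Finite F] [CommRing R]
    {g : Fˣ} (hg : ∀ x : Fˣ, x ∈ Subgroup.zpowers g) (χ : MulChar F R) (φ : R →+* F) {n : ℕ}
    (hn : n ≠ 0) (h : φ (χ g) = (g : F) ^ n) (x : F) : φ (χ x) = x ^ n := by
  rcases eq_or_ne x 0 with rfl | hx
  · rw [χ.map_zero, map_zero, zero_pow hn]
  · obtain ⟨j, hj⟩ := mem_powers_iff_mem_zpowers.2 (hg (Units.mk0 x hx))
    have hx' : x = (g : F) ^ j := by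
      simpa using (congrArg Units.val hj).symm
    rw [hx', map_pow, map_pow, h, pow_right_comm]

theorem pow_eq_one_of_apply_pow_eq_one {M R : Type*} [CommMonoid M] [CommMonoidWithZero R]
    {g : Mˣ} (hg : ∀ x : Mˣ, x ∈ Subgroup.zpowers g) {χ : MulChar M R} {n : ℕ}
    (hn : χ g ^ n = 1) : χ ^ n = 1 := by
  rw [eq_iff hg, pow_apply_coe, hn, one_apply_coe]

end MulChar

theorem Complex.cubeRoot_sq_add_self_add_one :
    ((-1 + (Real.sqrt 3 : ℂ) * Complex.I) / 2) ^ 2 + (-1 + (Real.sqrt 3 : ℂ) * Complex.I) / 2 + 1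
      = 0 := by
  have h : (Real.sqrt 3 : ℂ) ^ 2 = 3 := by
    rw [← Complex.ofReal_pow, Real.sq_sqrt (by norm_num)]; norm_num
  linear_combination (1 / 4 : ℂ) * (Real.sqrt 3 : ℂ) ^ 2 * Complex.I_sq - h / 4

theorem FiniteField.addChar_trace_isPrimitive (p : ℕ) [Fact p.Prime] {F : Type*} [Field F]
    [Finite F] [Algebra (ZMod p) F] {ψ : AddChar F ℂ}
    (hψ : ∀ x : F, ψ x = Complex.exp (2 * (Real.pi : ℂ) * Complex.I
      * ((Algebra.trace (ZMod p) F x).val : ℂ) / (p : ℂ))) : ψ.IsPrimitive := by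
  refine AddChar.IsPrimitive.of_ne_one fun h => ?_
  obtain ⟨x, hx⟩ := Algebra.trace_surjective (ZMod p) F 1
  have hp : p.Prime := Fact.out
  have : Fact (1 < p) := ⟨hp.one_lt⟩
  have h1 := hψ x
  rw [h, AddChar.one_apply, hx, ZMod.val_one, Nat.cast_one, mul_one] at h1
  exact (Complex.isPrimitiveRoot_exp p hp.ne_zero).ne_one hp.one_lt h1.symm

theorem gaussSum_cube_eq {F : Type*} [Field F] [Fintype F] {χ : MulChar F ℂ} {ψ : AddChar F ℂ}
    (hχ : orderOf χ = 3) (hψ : ψ.IsPrimitive) :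
    gaussSum χ ψ ^ 3 = Fintype.card F * jacobiSum χ χ := by
  have h := gaussSum_pow_eq_prod_jacobiSum (χ := χ) (by omega) hψ
  have h1 : χ (-1) = 1 := by
    have h2 : χ (-1) ^ 2 = 1 := by rw [← map_pow, neg_one_sq, map_one]
    have h3 : χ (-1) ^ 3 = 1 := by
      rw [← MulChar.pow_apply' _ three_ne_zero, ← hχ, pow_orderOf_eq_one]
      exact MulChar.one_apply isUnit_one.neg
    rw [pow_succ, h2, one_mul] at h3
    exact h3
  rw [hχ, h1] at h
  simpa using h

namespace EisensteinInt

variable {F : Type*} [Field F] [Fintype F] {g : Fˣ} {χ : MulChar F EisensteinInt}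

theorem three_dvd_jacobiSum_add_one (hχ : χ ^ 3 = 1) (hF : 3 ∣ Fintype.card F - 1) :
    3 ∣ jacobiSum χ χ + 1 := by
  obtain ⟨z, -, hz⟩ := exists_jacobiSum_eq_neg_one_add (by norm_num) hχ hχ hF
    isPrimitiveRoot_omega
  exact ⟨-ω * z, by rw [hz]; linear_combination z * omega_sq⟩

theorem norm_jacobiSum (hg : ∀ x : Fˣ, x ∈ Subgroup.zpowers g) (hχ : χ g = ω)
    (hF : ringChar F ≠ 0) :
    (jacobiSum χ χ).norm = Fintype.card F := by
  let ι : EisensteinInt →+* ℂ := liftHom _ Complex.cubeRoot_sq_add_self_add_one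
  obtain ⟨u, hu⟩ : ∃ u, u = ι ω := ⟨_, rfl⟩
  have hu0 : u ^ 2 + u + 1 = 0 := by
    rw [hu, ← map_pow, ← map_add, ← map_one ι, ← map_add, omega_sq, map_zero]
  have hg1 : χ.ringHomComp ι g = u := by rw [MulChar.ringHomComp_apply, hχ, hu]
  have h1 : χ.ringHomComp ι ≠ 1 := by
    rw [Ne, MulChar.eq_iff hg, hg1, MulChar.one_apply_coe]
    rintro rfl
    norm_num at hu0
  have h2 : χ.ringHomComp ι * χ.ringHomComp ι ≠ 1 := by
    rw [Ne, MulChar.eq_iff hg, MulChar.mul_apply, hg1, MulChar.one_apply_coe]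
    intro h
    have h3 : u = -2 := by linear_combination hu0 - h
    rw [h3] at h
    norm_num at h
  have h3 : χ.ringHomComp (ι.comp (starRingEnd _)) = (χ.ringHomComp ι)⁻¹ := by
    rw [eq_comm, inv_eq_iff_mul_eq_one, MulChar.eq_iff hg, MulChar.mul_apply, hg1,
      MulChar.ringHomComp_apply, hχ, MulChar.one_apply_coe, hu, RingHom.comp_apply, ← map_mul,
      starRingEnd_apply, mul_star_eq_norm, norm_eq]
    simp
  have h4 := jacobiSum_mul_jacobiSum_inv (by rwa [ringChar.eq_zero, ne_comm]) h1 h1 h2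
  rw [← h3, jacobiSum_ringHomComp, jacobiSum_ringHomComp, RingHom.comp_apply, ← map_mul,
    starRingEnd_apply, mul_star_eq_norm, map_intCast] at h4
  exact_mod_cast h4

end EisensteinInt

namespace EisensteinInt

/-- If `4p = r₁² + 27r₂²` with `r₁ ≡ 1` modulo `3`, then `(r₁ + 3r₂√-3) / 2` lies in `ℤ[ω]`, has
norm `p`, and is congruent to `-1` modulo `3`. -/
theorem exists_primary {p r1 r2 : ℤ} (hr4 : 4 * p = r1 ^ 2 + 27 * r2 ^ 2) (hr3 : r1 % 3 = 1) :
    ∃ π : EisensteinInt, 2 * π = (r1 : EisensteinInt) + 3 * (r2 : EisensteinInt) * (2 * ω + 1) ∧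
      π.norm = p ∧ 3 ∣ π + 1 := by
  obtain ⟨a, ha⟩ : ∃ a, r1 + 3 * r2 = 2 * a := by
    have h : Even (r1 ^ 2 + 27 * r2 ^ 2) := ⟨2 * p, by rw [← hr4]; ring⟩
    have h' : Even (r1 + 3 * r2) := by
      simp only [Int.even_add, Int.even_mul, Int.even_pow] at h ⊢
      revert h
      have h27 : ¬ Even (27 : ℤ) := by decide
      have h3 : ¬ Even (3 : ℤ) := by decide
      simp [h27, h3]
    obtain ⟨a, ha⟩ := h'
    exact ⟨a, by omega⟩
  obtain ⟨b, hb⟩ : ∃ b, a + 1 = 3 * b := ⟨(a + 1) / 3, by omega⟩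
  refine ⟨⟨a, 3 * r2⟩, ?_, ?_, ⟨⟨b, r2⟩, ?_⟩⟩
  · ext
    · simp; linarith
    · simp; ring
  · rw [norm_eq]
    have h1 : r1 = 2 * a - 3 * r2 := by linarith
    rw [h1] at hr4
    dsimp only
    linarith
  · ext
    · simp [hb]
    · simp

/-- The Jacobi sum `J(χ, χ)` of the cubic character sending the generator `g` to `ω` is the `k`-th
power of the prime `π = (r₁ + 3r₂√-3) / 2`. -/
theorem jacobiSum_eq_pow {F : Type*} [Field F] [Fintype F] {p k : ℕ} [Fact p.Prime] [CharP F p]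
    (hp3 : p % 3 = 1) (hk : Odd k) (hF : Fintype.card F = p ^ k) {g : Fˣ}
    (hg : ∀ x : Fˣ, x ∈ Subgroup.zpowers g) {χ : MulChar F EisensteinInt} (hχ : χ g = ω)
    {m : ℕ} (hm : p ^ k = 3 * m + 1) {r1 r2 : ℤ} {π : EisensteinInt}
    (hr : (9 * r2 : F) = (2 * (g : F) ^ m + 1) * r1)
    (hπ : 2 * π = (r1 : EisensteinInt) + 3 * (r2 : EisensteinInt) * (2 * ω + 1))
    (hnorm : π.norm = p) (hπ3 : 3 ∣ π + 1) :
    jacobiSum χ χ = π ^ k := by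
  have hp : p.Prime := Fact.out
  have hp7 : 7 ≤ p := by
    have := hp.two_le
    by_contra! h
    interval_cases p <;> first | omega | exact absurd hp (by decide)
  have hm0 : 0 < m := by
    have := Nat.le_self_pow hk.pos.ne' p
    omega
  have hne (n : ℕ) (hn : 0 < n) (hnp : n < p) : (n : F) ≠ 0 := fun h =>
    Nat.not_dvd_of_pos_of_lt hn hnp ((CharP.cast_eq_zero_iff F p n).1 h)
  have h2 : (2 : F) ≠ 0 := by exact_mod_cast hne 2 (by omega) (by omega)
  have h3 : (3 : F) ≠ 0 := by exact_mod_cast hne 3 (by omega) (by omega)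
  have hgord : orderOf g = 3 * m := by
    classical
    rw [orderOf_eq_card_of_forall_mem_zpowers hg, Nat.card_eq_fintype_card, Fintype.card_units,
      hF, hm, Nat.add_sub_cancel]
  have hc : ((g : F) ^ m) ^ 2 + (g : F) ^ m + 1 = 0 := by
    have h1 : (g : F) ^ m ≠ 1 := by
      rw [← Units.val_pow_eq_pow_val, Ne, Units.val_eq_one]
      exact pow_ne_one_of_lt_orderOf hm0.ne' (by omega)
    have h4 : ((g : F) ^ m) ^ 3 = 1 := by
      rw [← pow_mul, mul_comm, ← hgord, ← Units.val_pow_eq_pow_val, pow_orderOf_eq_one,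
        Units.val_one]
    refine (mul_eq_zero.1 ?_).resolve_left (sub_ne_zero.2 h1)
    linear_combination h4
  let φ : EisensteinInt →+* F := liftHom _ hc
  have hφω : φ ω = (g : F) ^ m := by simp [φ, liftHom_apply]
  have hφπ : φ π = 0 := by
    have h4 := congrArg φ hπ
    simp only [map_mul, map_add, map_ofNat, map_intCast, map_one, hφω] at h4
    have h5 : (2 * (2 * (g : F) ^ m + 1)) * φ π = 0 := by
      linear_combination (2 * (g : F) ^ m + 1) * h4 + 12 * r2 * hc - hr
    refine (mul_eq_zero.1 h5).resolve_left (mul_ne_zero h2 fun h6 => h3 ?_)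
    linear_combination 4 * hc - (2 * (g : F) ^ m + 1) * h6
  have hprime := prime_of_norm_eq p hp.ne_zero h3 hnorm φ hφπ
  have hχ3 : χ ^ 3 = 1 :=
    MulChar.pow_eq_one_of_apply_pow_eq_one hg (by rw [hχ, isPrimitiveRoot_omega.pow_eq_one])
  refine eq_pow_of_norm_eq hk hprime hnorm ?_ ?_ ?_ hπ3
  · rw [norm_jacobiSum hg hχ (by rw [ringChar.eq F p]; exact hp.ne_zero), hF, Nat.cast_pow]
  · intro hdvd
    obtain ⟨z, hz⟩ := hdvd
    have h4 : φ (star (jacobiSum χ χ)) = 0 := by rw [hz, map_mul, hφπ, zero_mul]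
    have hφω' : (φ.comp (starRingEnd _)) (χ g) = (g : F) ^ (2 * m) := by
      rw [hχ, RingHom.comp_apply, starRingEnd_apply]
      have : (star ω : EisensteinInt) = -1 - ω := by ext <;> simp
      rw [this, map_sub, map_neg, map_one, hφω]
      linear_combination -hc
    have h5 : φ (star (jacobiSum χ χ)) = ∑ x : F, x ^ (2 * m) * (1 - x) ^ (2 * m) := by
      rw [← starRingEnd_apply, ← RingHom.comp_apply, jacobiSum, map_sum]
      refine Finset.sum_congr rfl fun x _ => ?_
      rw [map_mul, MulChar.apply_ringHom_eq_pow hg χ _ (by omega) hφω',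
        MulChar.apply_ringHom_eq_pow hg χ _ (by omega) hφω']
    rw [h5, FiniteField.sum_pow_two_mul_one_sub_pow (hF.trans hm) hm0, neg_eq_zero] at h4
    refine not_dvd_choose_of_pow_eq hp3 k m hm ((CharP.cast_eq_zero_iff F p _).1 ?_)
    exact (mul_eq_zero.1 h4).resolve_left (pow_ne_zero _ (neg_ne_zero.2 one_ne_zero))
  · exact three_dvd_jacobiSum_add_one hχ3 (by rw [hF, hm]; exact ⟨m, by omega⟩)

end EisensteinInt

/-- If `k` is odd (so `p ≡ 1 (mod 3)`), then
`G(χ,ψ)³ = (p/2)^k · (r₁ + 3√3·r₂·i)^k` as complex numbers. -/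
theorem gaussSum_cube_odd_k
    (p k q : ℕ) [Fact p.Prime] (hk : 0 < k) (hq : q = p ^ k) (hq3 : q % 3 = 1)
    (hkodd : k % 2 = 1) (hp3 : p % 3 = 1)
    (F : Type) [Field F] [Fintype F] [Algebra (ZMod p) F] (hF : Fintype.card F = q)
    (g : Fˣ) (hg : ∀ x : Fˣ, x ∈ Subgroup.zpowers g)
    (χ : MulChar F ℂ) (hχ : χ (g : F) = (-1 + (Real.sqrt 3 : ℂ) * Complex.I) / 2)
    (ψ : AddChar F ℂ)
    (hψ : ∀ x : F, ψ x = Complex.exp (2 * (Real.pi : ℂ) * Complex.I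
      * ((Algebra.trace (ZMod p) F x).val : ℂ) / (p : ℂ)))
    (r1 r2 : ℤ) (hr4 : 4 * (p : ℤ) = r1 ^ 2 + 27 * r2 ^ 2) (hr3 : r1 % 3 = 1)
    (hr : ((9 * r2 : ℤ) : ZMod p)
      = (2 * (Algebra.norm (ZMod p) ((g : F))) ^ ((p - 1) / 3) + 1)
          * ((r1 : ℤ) : ZMod p)) :
    gaussSum χ ψ ^ 3
      = ((p : ℂ) / 2) ^ k
          * ((r1 : ℂ) + 3 * (Real.sqrt 3 : ℂ) * (r2 : ℂ) * Complex.I) ^ k := by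
  classical
  have hp : p.Prime := Fact.out
  have : CharP F p := charP_of_injective_algebraMap (algebraMap (ZMod p) F).injective p
  obtain ⟨m, hm⟩ : ∃ m, p ^ k = 3 * m + 1 := ⟨q / 3, by omega⟩
  obtain ⟨t, ht⟩ : ∃ t, p - 1 = 3 * t := ⟨p / 3, by omega⟩
  have hnorm : (algebraMap (ZMod p) F (Algebra.norm (ZMod p) (g : F))) ^ ((p - 1) / 3)
      = (g : F) ^ m := by
    obtain ⟨s, hs⟩ := Nat.sub_dvd_pow_sub_pow p 1 k
    rw [one_pow] at hs
    have ht0 : 0 < t := by have := hp.two_le; omega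
    have hmst : m = s * t := by
      have : 3 * m = 3 * (s * t) := by rw [← Nat.add_sub_cancel (3 * m) 1, ← hm, hs, ht]; ring
      omega
    rw [FiniteField.algebraMap_norm_eq_pow, Nat.card_eq_fintype_card, Nat.card_eq_fintype_card,
      ZMod.card, hF, hq, hs, Nat.mul_div_cancel_left _ (by omega), ← pow_mul, ht,
      Nat.mul_div_cancel_left _ (by norm_num), hmst]
  have hrF : (9 * r2 : F) = (2 * (g : F) ^ m + 1) * r1 := by
    have h := congrArg (algebraMap (ZMod p) F) hr
    rw [map_intCast, map_mul, map_add, map_mul, map_pow, hnorm, map_ofNat, map_one,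
      map_intCast] at h
    exact_mod_cast h
  obtain ⟨π, hπ, hπn, hπ3⟩ := EisensteinInt.exists_primary hr4 hr3
  have hω3 : (ω : EisensteinInt) ^ 3 = 1 := EisensteinInt.isPrimitiveRoot_omega.pow_eq_one
  let ωu : EisensteinIntˣ := Units.ofPowEqOne ω 3 hω3 three_ne_zero
  have hωu : ωu ∈ rootsOfUnity (Fintype.card Fˣ) EisensteinInt := by
    have h3 : ωu ^ 3 = 1 := Units.ext hω3
    rw [mem_rootsOfUnity, Fintype.card_units, hF, hq, hm, Nat.add_sub_cancel, pow_mul, h3, one_pow]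
  let χE : MulChar F EisensteinInt := MulChar.ofRootOfUnity hωu hg
  have hχE : χE g = ω := MulChar.ofRootOfUnity_spec hωu hg
  let ι := EisensteinInt.liftHom _ Complex.cubeRoot_sq_add_self_add_one
  have hιω : ι ω = (-1 + (Real.sqrt 3 : ℂ) * Complex.I) / 2 := by
    simp [ι, EisensteinInt.liftHom_apply]
  have hχι : χ = χE.ringHomComp ι := by
    rw [MulChar.eq_iff hg, MulChar.ringHomComp_apply, hχE, hχ, hιω]
  have hord : orderOf χ = 3 := by
    refine orderOf_eq_prime (MulChar.pow_eq_one_of_apply_pow_eq_one hg ?_) fun h => ?_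
    · rw [hχ, ← hιω, ← map_pow, hω3, map_one]
    · have h1 : ι ω = 1 := by rw [hιω, ← hχ, h, MulChar.one_apply_coe]
      have h2 := Complex.cubeRoot_sq_add_self_add_one
      rw [← hιω, h1] at h2
      norm_num at h2
  rw [gaussSum_cube_eq hord (FiniteField.addChar_trace_isPrimitive p hψ), hχι,
    jacobiSum_ringHomComp, EisensteinInt.jacobiSum_eq_pow hp3 (Nat.odd_iff.2 hkodd)
      (hF.trans hq) hg hχE hm hrF hπ hπn hπ3, hF, hq, map_pow, Nat.cast_pow, ← mul_pow, ← mul_pow]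
  congr 1
  have h := congrArg ι hπ
  simp only [map_mul, map_add, map_ofNat, map_intCast, map_one, hιω] at h
  linear_combination (p / 2 : ℂ) * h
end

section
/- Set u_s(z) = N_s(z) − q^{s-1}. Then: u_1(g) = u_1(g²) = −1 and u_1(g³) = 2; u_2(g) = −2 − c/2 + (9d/2)·θ(q), u_2(g²) = −2 − c/2 − (9d/2)·θ(q), and u_2(g³) = −2 + c; u_3(g) = u_3(g²) = −3q − c and u_3(g³) = 6q − c. -/
/-- `Ncube F s z` is the number of `s`-tuples `(x₁, …, x_s) ∈ F^s` with
`x₁³ + ⋯ + x_s³ = z`. -/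
noncomputable def Ncube (F : Type) [Field F] [Fintype F] (s : ℕ) (z : F) : ℕ :=
  Nat.card {x : Fin s → F // ∑ i, x i ^ 3 = z}

section

open Finset

lemma Ncube_succ (F : Type) [Field F] [Fintype F] (s : ℕ) (z : F) :
    Ncube F (s + 1) z = ∑ x : F, Ncube F s (z - x ^ 3) := by
  unfold Ncube
  rw [← Nat.card_sigma]
  refine Nat.card_congr
    { toFun := fun y ↦ ⟨y.1 0, fun i ↦ y.1 i.succ, ?_⟩
      invFun := fun y ↦ ⟨Fin.cons y.1 y.2.1, ?_⟩
      left_inv := ?_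
      right_inv := ?_ }
  · have h := y.2
    rw [Fin.sum_univ_succ] at h
    exact eq_sub_of_add_eq' h
  · have h := y.2.2
    rw [Fin.sum_univ_succ]
    simp only [Fin.cons_zero, Fin.cons_succ]
    rw [h]
    ring
  · rintro ⟨y, hy⟩
    ext i
    refine Fin.cases ?_ (fun i ↦ ?_) i <;> simp
  · rintro ⟨x, y, hy⟩
    rfl

lemma Ncube_one (F : Type) [Field F] [Fintype F] (z : F) :
    Ncube F 1 z = Nat.card {x : F // x ^ 3 = z} := by
  unfold Ncube
  exact Nat.card_congr ((Equiv.funUnique (Fin 1) F).subtypeEquiv fun x ↦ by simp)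

lemma sum_comp_cube {F R : Type*} [Field F] [Fintype F] [CommRing R] (h : F → R) :
    ∑ x : F, h (x ^ 3) = ∑ t : F, (Nat.card {x : F // x ^ 3 = t} : R) * h t := by
  classical
  rw [← Finset.sum_fiberwise univ (fun x : F ↦ x ^ 3)]
  refine sum_congr rfl fun t _ ↦ ?_
  rw [sum_congr rfl (g := fun _ ↦ h t) (fun x hx ↦ by rw [(mem_filter.1 hx).2]), sum_const,
    nsmul_eq_mul, Nat.card_eq_fintype_card, Fintype.card_subtype]

lemma natCard_cube_eq_zero (F : Type*) [Field F] : Nat.card {x : F // x ^ 3 = 0} = 1 := by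
  simp

/-- The number of cube roots of a unit, in terms of a cubic character. -/
lemma natCard_cube_eq_unit {F R : Type*} [Field F] [Finite F] [CommRing R] [IsDomain R] {g : Fˣ}
    (hg : ∀ x : Fˣ, x ∈ Subgroup.zpowers g) {ζ : F} (hζ : IsPrimitiveRoot ζ 3)
    (f : Fˣ →* R) (hf : IsPrimitiveRoot (f g) 3) (u : Fˣ) :
    (Nat.card {x : F // x ^ 3 = u} : R) = 1 + f u + f u ^ 2 := by
  classical
  have hcard : Nat.card {x : F // x ^ 3 = u} = if ∃ α : F, α ^ 3 = u then 3 else 0 := by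
    rw [← hζ.card_nthRoots (u : F),
      ← Multiset.toFinset_card_of_nodup (hζ.nthRoots_nodup u.ne_zero), ← Nat.card_eq_finsetCard]
    refine Nat.card_congr (Equiv.subtypeEquivRight fun x ↦ ?_)
    simp [Polynomial.mem_nthRoots]
  rw [hcard]
  have hcube : ∀ v : Fˣ, f v ^ 3 = 1 := fun v ↦ by
    obtain ⟨j, rfl⟩ := mem_powers_iff_mem_zpowers.2 (hg v)
    simp only [map_pow]
    rw [pow_right_comm, hf.pow_eq_one, one_pow]
  split_ifs with h
  · obtain ⟨α, hα⟩ := h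
    have hα0 : α ≠ 0 := by
      rintro rfl
      exact u.ne_zero (by rw [← hα]; simp)
    have hu : u = Units.mk0 α hα0 ^ 3 := by
      ext
      simp [hα]
    rw [hu, map_pow, hcube]
    norm_num
  · have hne : f u ≠ 1 := fun h1 ↦ h <| by
      obtain ⟨j, rfl⟩ := mem_powers_iff_mem_zpowers.2 (hg u)
      simp only [map_pow] at h1
      obtain ⟨m, rfl⟩ := (hf.pow_eq_one_iff_dvd j).1 h1
      exact ⟨(g : F) ^ m, by push_cast; ring⟩
    have h0 : (f u - 1) * (1 + f u + f u ^ 2) = 0 := by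
      linear_combination hcube u
    simpa using ((mul_eq_zero.1 h0).resolve_left (sub_ne_zero.2 hne)).symm

lemma cubic_ne_one {F R : Type*} [Field F] [CommRing R] {χ : MulChar F R}
    (hχ : orderOf χ = 3) :
    χ ≠ 1 ∧ χ⁻¹ ≠ 1 ∧ χ * χ = χ⁻¹ ∧ χ⁻¹ * χ⁻¹ = χ := by
  have h3 : χ ^ 3 = 1 := by rw [← hχ, pow_orderOf_eq_one]
  have h1 : χ ≠ 1 := by
    rintro rfl
    simp at hχ
  refine ⟨h1, inv_ne_one.2 h1, ?_, ?_⟩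
  · rw [eq_inv_iff_mul_eq_one, ← h3, pow_three']
  · rw [← mul_inv, inv_eq_iff_mul_eq_one, ← h3, pow_three']

lemma cubic_neg_one {F R : Type*} [Field F] [CommRing R] {χ : MulChar F R}
    (hχ : orderOf χ = 3) : χ (-1) = 1 := by
  have h3 : χ ^ 3 = 1 := by rw [← hχ, pow_orderOf_eq_one]
  have h : (χ ^ 3) (-1) = χ (-1) := by
    rw [MulChar.pow_apply' _ (by norm_num), ← map_pow]
    norm_num
  rw [← h, h3]
  exact MulChar.one_apply (by simp)

section Jacobi

variable {F R : Type*} [Field F] [Fintype F] [CommRing R]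

lemma sum_mulChar_mul_mulChar_sub (χ φ : MulChar F R) {z : F} (hz : z ≠ 0) :
    ∑ t, χ t * φ (z - t) = χ z * φ z * jacobiSum χ φ := by
  rw [jacobiSum, mul_sum, ← Equiv.sum_comp (Equiv.mulLeft₀ z hz)]
  refine sum_congr rfl fun t _ ↦ ?_
  rw [Equiv.mulLeft₀_apply, show z - z * t = z * (1 - t) by ring, map_mul, map_mul]
  ring

lemma sum_mulChar_sub [IsDomain R] {χ : MulChar F R} (hχ : χ ≠ 1) (z : F) :
    ∑ t, χ (z - t) = 0 := by
  rw [← MulChar.sum_eq_zero_of_ne_one hχ, ← Equiv.sum_comp (Equiv.subLeft z)]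
  simp

lemma sum_mulChar_mul_mulChar_neg (χ φ : MulChar F R) :
    ∑ t, χ t * φ (0 - t) = φ (-1) * ∑ t, (χ * φ) t := by
  rw [mul_sum]
  refine sum_congr rfl fun t _ ↦ ?_
  rw [show 0 - t = -1 * t by ring, map_mul, MulChar.mul_apply]
  ring

lemma sum_one_mulChar [DecidableEq F] : ∑ t, (1 : MulChar F R) t = (Fintype.card F : R) - 1 := by
  rw [MulChar.sum_one_eq_card_units, Fintype.card_units, Nat.cast_sub Fintype.card_pos, Nat.cast_one]

end Jacobi

lemma dvd_of_dvd_sq_add {p : ℕ} [Fact p.Prime] (hp : p % 3 = 2) (hp2 : p ≠ 2) {c d : ℤ}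
    (h : (p : ℤ) ∣ c ^ 2 + 27 * d ^ 2) : (p : ℤ) ∣ d := by
  have h2 : (2 : ZMod p) ≠ 0 := fun h0 ↦ hp2 <|
    (Nat.prime_dvd_prime_iff_eq Fact.out Nat.prime_two).1
      ((ZMod.natCast_eq_zero_iff 2 p).1 (by exact_mod_cast h0))
  have h3 : (3 : ZMod p) ≠ 0 := fun h0 ↦ by
    have := (Nat.prime_dvd_prime_iff_eq Fact.out Nat.prime_three).1
      ((ZMod.natCast_eq_zero_iff 3 p).1 (by exact_mod_cast h0))
    omega
  rw [← ZMod.intCast_zmod_eq_zero_iff_dvd] at h ⊢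
  by_contra hd
  push_cast at h
  set x : ZMod p := (c : ZMod p) / (3 * d) with hx
  have hx3 : x ^ 2 = -3 := by
    rw [hx]
    field_simp
    linear_combination h
  set w : ZMod p := (x - 1) / 2 with hw
  have hxw : x = 2 * w + 1 := by
    rw [hw]
    field_simp
    ring
  have hw1 : w ^ 2 + w + 1 = 0 := by
    rw [hxw] at hx3
    have : (2 * 2) * (w ^ 2 + w + 1) = 0 := by linear_combination hx3
    exact (mul_eq_zero.1 this).resolve_left (mul_ne_zero h2 h2)
  have hw0 : w ≠ 0 := by
    intro h0
    simp [h0] at hw1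
  have hwp := ZMod.pow_card_sub_one_eq_one hw0
  obtain ⟨m, hm⟩ : ∃ m, p - 1 = 3 * m + 1 := ⟨(p - 1) / 3, by omega⟩
  have hw3 : w ^ 3 = 1 := by linear_combination (w - 1) * hw1
  rw [hm, pow_add, pow_mul, hw3, one_pow, one_mul, pow_one] at hwp
  rw [hwp] at hw1
  exact h3 (by linear_combination hw1)

lemma dvd_and_dvd_of_four_mul {p : ℕ} [Fact p.Prime] (hp : p % 3 = 2) {c d : ℤ}
    (h : (4 * p : ℤ) ∣ c ^ 2 + 27 * d ^ 2) : (p : ℤ) ∣ c ∧ (p : ℤ) ∣ d := by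
  have hpp : Prime (p : ℤ) := Nat.prime_iff_prime_int.1 Fact.out
  rcases eq_or_ne p 2 with rfl | hp2
  · have h8 : (c ^ 2 + 27 * d ^ 2) % 8 = 0 := Int.emod_eq_zero_of_dvd (by simpa using h)
    have hc : c % 8 = 0 ∨ c % 8 = 1 ∨ c % 8 = 2 ∨ c % 8 = 3 ∨ c % 8 = 4 ∨ c % 8 = 5 ∨ c % 8 = 6 ∨
      c % 8 = 7 := by omega
    have hd : d % 8 = 0 ∨ d % 8 = 1 ∨ d % 8 = 2 ∨ d % 8 = 3 ∨ d % 8 = 4 ∨ d % 8 = 5 ∨ d % 8 = 6 ∨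
      d % 8 = 7 := by omega
    have key : c % 2 = 0 ∧ d % 2 = 0 := by
      rcases hc with hc | hc | hc | hc | hc | hc | hc | hc <;>
      rcases hd with hd | hd | hd | hd | hd | hd | hd | hd <;>
      first
      | omega
      | (simp [pow_two, Int.add_emod, Int.mul_emod, hc, hd] at h8)
    push_cast
    omega
  · have hdvd : (p : ℤ) ∣ c ^ 2 + 27 * d ^ 2 := (Dvd.intro_left _ rfl).trans h
    have hd := dvd_of_dvd_sq_add hp hp2 hdvd
    refine ⟨hpp.dvd_of_dvd_pow (n := 2) ?_, hd⟩
    exact (dvd_add_left ((hd.trans (dvd_pow_self d two_ne_zero)).mul_left 27)).1 hdvd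

lemma eq_zero_of_four_mul_prime_pow_eq {p : ℕ} [Fact p.Prime] (hp : p % 3 = 2) (k : ℕ) :
    ∀ c d : ℤ, 4 * (p : ℤ) ^ k = c ^ 2 + 27 * d ^ 2 → d = 0 := by
  have hp0 : 2 ≤ (p : ℤ) := by exact_mod_cast (Fact.out : p.Prime).two_le
  have small : ∀ a c d : ℤ, a * (c ^ 2 + 27 * d ^ 2) = 4 → 1 ≤ a → d = 0 := by
    intro a c d h ha
    by_contra hd
    have : 0 < d ^ 2 := by positivity
    nlinarith [sq_nonneg c]
  induction k using Nat.twoStepInduction with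
  | zero =>
    intro c d h
    exact small 1 c d (by linarith) le_rfl
  | one =>
    intro c d h
    obtain ⟨⟨x, rfl⟩, ⟨y, rfl⟩⟩ := dvd_and_dvd_of_four_mul hp (c := c) (d := d) ⟨1, by linarith⟩
    have := small p x y (mul_left_cancel₀ (by positivity : (p : ℤ) ≠ 0) (by linarith)) (by linarith)
    rw [this, mul_zero]
  | more k ih _ =>
    intro c d h
    obtain ⟨⟨x, rfl⟩, ⟨y, rfl⟩⟩ := dvd_and_dvd_of_four_mul hp (c := c) (d := d)
      ⟨(p : ℤ) ^ (k + 1), by rw [← h]; ring⟩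
    have := ih x y (mul_left_cancel₀ (by positivity : (p : ℤ) ^ 2 ≠ 0) (by linear_combination h))
    rw [this, mul_zero]

/-- Uniqueness, up to signs, of the representation `4 p ^ k = c ^ 2 + 27 d ^ 2` with `p ∤ c`. -/
lemma sq_eq_sq_of_not_dvd {p : ℕ} [Fact p.Prime] (hp2 : p ≠ 2) (k : ℕ) {c d A B : ℤ}
    (h : 4 * (p : ℤ) ^ k = c ^ 2 + 27 * d ^ 2) (h' : 4 * (p : ℤ) ^ k = A ^ 2 + 27 * B ^ 2)
    (hc : ¬ (p : ℤ) ∣ c) (hA : ¬ (p : ℤ) ∣ A) : c ^ 2 = A ^ 2 := by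
  have hpp : Prime (p : ℤ) := Nat.prime_iff_prime_int.1 Fact.out
  have hp0 : (p : ℤ) ≠ 0 := hpp.ne_zero
  have hp2' : ¬ (p : ℤ) ∣ 2 := fun h0 ↦ hp2 <|
    (Nat.prime_dvd_prime_iff_eq Fact.out Nat.prime_two).1 (by exact_mod_cast h0)
  have hq : 0 < (p : ℤ) ^ k := by
    have := (Fact.out : p.Prime).pos
    positivity
  have main : ∀ e : ℤ, e ^ 2 = d ^ 2 → (p : ℤ) ^ k ∣ c * B - A * e → c ^ 2 = A ^ 2 := by
    rintro e he ⟨m, hm⟩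
    have h1 : (c * A + 27 * e * B) ^ 2 + 27 * (c * B - A * e) ^ 2 = 16 * ((p : ℤ) ^ k) ^ 2 := by
      have : (c ^ 2 + 27 * e ^ 2) * (A ^ 2 + 27 * B ^ 2) = 16 * ((p : ℤ) ^ k) ^ 2 := by
        rw [he, ← h, ← h']
        ring
      linear_combination this
    have hm0 : m = 0 := by
      by_contra hm0
      have : 0 < m ^ 2 := by positivity
      rw [hm] at h1
      nlinarith [sq_nonneg (c * A + 27 * e * B), pow_pos hq 2]
    rw [hm0, mul_zero] at hm
    have h2 : 4 * (p : ℤ) ^ k * c ^ 2 = 4 * (p : ℤ) ^ k * A ^ 2 := by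
      have : c ^ 2 * B ^ 2 = A ^ 2 * e ^ 2 := by linear_combination (c * B + A * e) * hm
      rw [he] at this
      linear_combination c ^ 2 * h' - A ^ 2 * h + 27 * this
    exact mul_left_cancel₀ (by positivity) h2
  rcases Nat.eq_zero_or_pos k with rfl | hk
  · exact main d rfl (by simp)
  have hprod : (p : ℤ) ^ k ∣ (c * B - A * d) * (c * B - A * (-d)) :=
    ⟨4 * (B ^ 2 - d ^ 2), by linear_combination -B ^ 2 * h + d ^ 2 * h'⟩
  by_cases h1 : (p : ℤ) ∣ c * B - A * d
  · have h2 : ¬ (p : ℤ) ∣ c * B - A * (-d) := by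
      intro h2
      have h3 : (p : ℤ) ∣ 2 * (c * B) := by
        rw [show 2 * (c * B) = (c * B - A * d) + (c * B - A * -d) by ring]
        exact dvd_add h1 h2
      have hB : (p : ℤ) ∣ B :=
        (hpp.dvd_or_dvd ((hpp.dvd_or_dvd h3).resolve_left hp2')).resolve_left hc
      apply hA
      apply hpp.dvd_of_dvd_pow (n := 2)
      rw [show A ^ 2 = 4 * (p : ℤ) ^ k - B * (27 * B) by linear_combination -h']
      exact dvd_sub ((dvd_pow_self _ hk.ne').mul_left 4) (hB.mul_right _)
    exact main d rfl (((hpp.coprime_iff_not_dvd.2 h2).pow_left).dvd_of_dvd_mul_right hprod)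
  · exact main (-d) (neg_sq d)
      (((hpp.coprime_iff_not_dvd.2 h1).pow_left).dvd_of_dvd_mul_left hprod)

lemma not_dvd_choose_of_three_mul {p : ℕ} [Fact p.Prime] (hp : p % 3 = 1) (k : ℕ) :
    ∀ n, 3 * n + 1 = p ^ k → ¬ p ∣ (2 * n).choose n := by
  have hpp : p.Prime := Fact.out
  obtain ⟨m, hm⟩ : ∃ m, p = 3 * m + 1 := ⟨p / 3, by omega⟩
  induction k with
  | zero =>
    intro n hn
    obtain rfl : n = 0 := by simpa using hn
    simpa using hpp.one_lt.ne'
  | succ k ih =>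
    intro n hn
    obtain ⟨l, hl⟩ : ∃ l, 3 * l + 1 = p ^ k := by
      have : p ^ k % 3 = 1 := by simp [Nat.pow_mod, hp]
      exact ⟨p ^ k / 3, by omega⟩
    have hn' : n = m + p * l := by
      rw [pow_succ, ← hl] at hn
      nlinarith
    have hm1 : m < p := by omega
    have hm2 : 2 * m < p := by omega
    have h2n : 2 * n = 2 * m + p * (2 * l) := by rw [hn']; ring
    have hluc := Choose.choose_modEq_choose_mod_mul_choose_div_nat (n := 2 * n) (k := n) (p := p)
    rw [h2n, hn', Nat.add_mul_mod_self_left, Nat.add_mul_mod_self_left,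
      Nat.add_mul_div_left _ _ hpp.pos, Nat.add_mul_div_left _ _ hpp.pos, Nat.mod_eq_of_lt hm1,
      Nat.mod_eq_of_lt hm2, Nat.div_eq_of_lt hm1, Nat.div_eq_of_lt hm2, zero_add, zero_add,
      ← hn', ← h2n] at hluc
    rw [hluc.dvd_iff dvd_rfl, hpp.dvd_mul]
    rintro (h | h)
    · have hfac : (2 * m).choose m ∣ (2 * m).factorial := by
        rw [← Nat.choose_mul_factorial_mul_factorial (show m ≤ 2 * m by omega), mul_assoc]
        exact Dvd.intro _ rfl
      exact hm2.not_ge (hpp.dvd_factorial.1 (h.trans hfac))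
    · exact ih l hl h

section PowerSums

variable {F : Type*} [Field F] [Fintype F]

lemma sum_pow_of_pos {i : ℕ} (hi : 0 < i) :
    ∑ x : F, x ^ i = if Fintype.card F - 1 ∣ i then -1 else 0 := by
  classical
  rw [← FiniteField.sum_pow_units, ← sum_subset (subset_univ (univ.map ⟨_, Units.val_injective⟩))]
  · simp
  · intro x _ hx
    have : x = 0 := by
      by_contra h0
      exact hx (by simpa using (⟨Units.mk0 x h0, rfl⟩ : IsUnit x))
    rw [this, zero_pow hi.ne']

lemma sum_one_sub_cube_pow {n m : ℕ} (hn : 3 * n + 1 = Fintype.card F) :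
    ∑ x : F, (1 - x ^ 3) ^ m
      = -∑ i ∈ (range (m + 1)).filter (fun i ↦ 0 < i ∧ n ∣ i), (-1) ^ i * (m.choose i : F) := by
  have h1 : ∀ x : F, (1 - x ^ 3) ^ m
      = ∑ i ∈ range (m + 1), ((-1) ^ i * (m.choose i : F)) * x ^ (3 * i) := fun x ↦ by
    rw [show 1 - x ^ 3 = -x ^ 3 + 1 by ring, add_pow]
    refine sum_congr rfl fun i _ ↦ ?_
    rw [neg_pow, ← pow_mul]
    ring
  rw [sum_congr rfl fun x _ ↦ h1 x, sum_comm, sum_filter, ← sum_neg_distrib]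
  refine sum_congr rfl fun i _ ↦ ?_
  rw [← mul_sum]
  rcases Nat.eq_zero_or_pos i with rfl | hi
  · simp
  · rw [sum_pow_of_pos (by omega), ← hn, Nat.add_sub_cancel]
    by_cases h : n ∣ i <;> simp [Nat.mul_dvd_mul_iff_left (show 0 < 3 by norm_num), h, hi]

lemma sum_one_add_one_sub_cube_pow {n : ℕ} (hn : 3 * n + 1 = Fintype.card F) (hev : Even n)
    (hpos : 0 < n) :
    ∑ x : F, (1 + (1 - x ^ 3) ^ n + ((1 - x ^ 3) ^ n) ^ 2) = -2 - ((2 * n).choose n : F) := by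
  have e1 : (range (n + 1)).filter (fun i ↦ 0 < i ∧ n ∣ i) = {n} := by
    ext i
    simp only [mem_filter, mem_range, mem_singleton]
    constructor
    · rintro ⟨h1, h2, h3⟩
      have := Nat.le_of_dvd h2 h3
      omega
    · rintro rfl
      exact ⟨by omega, hpos, dvd_rfl⟩
  have e2 : (range (2 * n + 1)).filter (fun i ↦ 0 < i ∧ n ∣ i) = {n, 2 * n} := by
    ext i
    simp only [mem_filter, mem_range, mem_singleton, mem_insert]
    constructor
    · rintro ⟨h1, h2, j, rfl⟩
      have hj : j ≤ 2 := by
        by_contra! hj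
        nlinarith
      interval_cases j <;> omega
    · rintro (rfl | rfl)
      · exact ⟨by omega, hpos, dvd_rfl⟩
      · exact ⟨by omega, by omega, Dvd.intro_left _ rfl⟩
  simp only [← pow_mul, mul_comm n 2]
  rw [sum_add_distrib, sum_add_distrib, sum_one_sub_cube_pow hn, sum_one_sub_cube_pow hn, e1, e2,
    sum_singleton, sum_pair (by omega), sum_const, card_univ, nsmul_eq_mul, Nat.cast_card_eq_zero]
  rw [hev.neg_one_pow, (even_two_mul n).neg_one_pow, Nat.choose_self, Nat.choose_self]
  push_cast
  ring

end PowerSums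

lemma isPrimitiveRoot_generator_pow {F : Type*} [Field F] [Fintype F] {g : Fˣ}
    (hg : ∀ x : Fˣ, x ∈ Subgroup.zpowers g) {n : ℕ} (hn : 3 * n + 1 = Fintype.card F) :
    IsPrimitiveRoot ((g : F) ^ n) 3 := by
  classical
  have ho : orderOf g = 3 * n := by
    rw [orderOf_eq_card_of_forall_mem_zpowers hg, Nat.card_eq_fintype_card, Fintype.card_units]
    omega
  have hpos : 0 < 3 * n := ho ▸ orderOf_pos g
  exact ((IsPrimitiveRoot.iff_orderOf.2 ho).map_of_injective (f := Units.coeHom F)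
    Units.val_injective).pow hpos (mul_comm _ _)

lemma cast_Ncube_two_one {F : Type} [Field F] [Fintype F] {g : Fˣ}
    (hg : ∀ x : Fˣ, x ∈ Subgroup.zpowers g) {n : ℕ} (hn : 3 * n + 1 = Fintype.card F)
    (hev : Even n) (hpos : 0 < n) :
    (Ncube F 2 1 : F) = -2 - ((2 * n).choose n : F) := by
  rw [← sum_one_add_one_sub_cube_pow hn hev hpos, Ncube_succ]
  push_cast
  refine sum_congr rfl fun x _ ↦ ?_
  rw [Ncube_one]
  have hζ := isPrimitiveRoot_generator_pow hg hn
  rcases eq_or_ne (1 - x ^ 3) 0 with h | h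
  · rw [h, natCard_cube_eq_zero]
    simp [hpos.ne']
  · simpa using natCard_cube_eq_unit hg hζ ((Units.coeHom F).comp (powMonoidHom n))
      (by simpa using hζ) (Units.mk0 _ h)

section CubicCharacter

variable {F : Type} [Field F] [Fintype F] {χ : MulChar F ℂ}

lemma orderOf_cubic {R : Type*} [CommRing R] {χ : MulChar F R} {g : Fˣ}
    (hg : ∀ x : Fˣ, x ∈ Subgroup.zpowers g) (h : IsPrimitiveRoot (χ g) 3) : orderOf χ = 3 := by
  have : Fact (Nat.Prime 3) := ⟨Nat.prime_three⟩
  refine orderOf_eq_prime (MulChar.ext fun u ↦ ?_) ?_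
  · obtain ⟨j, rfl⟩ := mem_powers_iff_mem_zpowers.2 (hg u)
    simp only [MulChar.pow_apply_coe, Units.val_pow_eq_pow_val, map_pow, MulChar.one_apply_coe]
    rw [h.pow_eq_one]
  · rintro rfl
    exact h.ne_one (by norm_num) (MulChar.one_apply_coe g)

lemma natCard_cube_eq {g : Fˣ} (hg : ∀ x : Fˣ, x ∈ Subgroup.zpowers g) {ζ : F}
    (hζ : IsPrimitiveRoot ζ 3) (h : IsPrimitiveRoot (χ g) 3) (t : F) :
    (Nat.card {x : F // x ^ 3 = t} : ℂ) = 1 + χ t + χ⁻¹ t := by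
  rcases eq_or_ne t 0 with rfl | ht
  · rw [natCard_cube_eq_zero, MulChar.map_zero, MulChar.map_zero]
    simp
  · have := natCard_cube_eq_unit hg hζ ((Units.coeHom ℂ).comp χ.toUnitHom)
      (by simpa using h) (Units.mk0 t ht)
    rw [← (cubic_ne_one (orderOf_cubic hg h)).2.2.1, MulChar.mul_apply, ← sq]
    simpa using this

lemma Ncube_two_of_ne_zero (hχ : orderOf χ = 3)
    (hr : ∀ t : F, (Nat.card {x : F // x ^ 3 = t} : ℂ) = 1 + χ t + χ⁻¹ t) {z : F} (hz : z ≠ 0) :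
    (Ncube F 2 z : ℂ) = Fintype.card F - 2 + χ⁻¹ z * jacobiSum χ χ
      + χ z * jacobiSum χ⁻¹ χ⁻¹ := by
  obtain ⟨h1, h1', h2, h2'⟩ := cubic_ne_one hχ
  have hexp : ∀ t, (1 + χ t + χ⁻¹ t) * (1 + χ (z - t) + χ⁻¹ (z - t))
      = 1 + χ t + χ⁻¹ t + χ (z - t) + χ⁻¹ (z - t) + χ t * χ (z - t) + χ⁻¹ t * χ⁻¹ (z - t)
        + χ t * χ⁻¹ (z - t) + χ⁻¹ t * χ (z - t) := fun t ↦ by ring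
  have hinv : χ z * χ⁻¹ z = 1 := by
    rw [← MulChar.mul_apply, mul_inv_cancel, MulChar.one_apply hz.isUnit]
  rw [Ncube_succ]
  push_cast
  simp only [Ncube_one]
  rw [sum_comp_cube fun t ↦ (Nat.card {x : F // x ^ 3 = z - t} : ℂ)]
  simp only [hr, hexp, sum_add_distrib, MulChar.sum_eq_zero_of_ne_one h1,
    MulChar.sum_eq_zero_of_ne_one h1', sum_mulChar_sub h1, sum_mulChar_sub h1',
    sum_mulChar_mul_mulChar_sub _ _ hz]
  rw [jacobiSum_comm χ⁻¹ χ, jacobiSum_nontrivial_inv h1, cubic_neg_one hχ, ← MulChar.mul_apply,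
    ← MulChar.mul_apply, h2, h2']
  simp only [sum_const, card_univ, nsmul_eq_mul, mul_one, add_zero]
  linear_combination -2 * hinv

lemma Ncube_two_zero (hχ : orderOf χ = 3)
    (hr : ∀ t : F, (Nat.card {x : F // x ^ 3 = t} : ℂ) = 1 + χ t + χ⁻¹ t) :
    (Ncube F 2 0 : ℂ) = 3 * Fintype.card F - 2 := by
  classical
  obtain ⟨h1, h1', h2, h2'⟩ := cubic_ne_one hχ
  have hexp : ∀ t, (1 + χ t + χ⁻¹ t) * (1 + χ (0 - t) + χ⁻¹ (0 - t))
      = 1 + χ t + χ⁻¹ t + χ (0 - t) + χ⁻¹ (0 - t) + χ t * χ (0 - t) + χ⁻¹ t * χ⁻¹ (0 - t)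
        + χ t * χ⁻¹ (0 - t) + χ⁻¹ t * χ (0 - t) := fun t ↦ by ring
  have hneg' : χ⁻¹ (-1) = 1 := cubic_neg_one (by rw [orderOf_inv, hχ])
  rw [Ncube_succ]
  push_cast
  simp only [Ncube_one]
  rw [sum_comp_cube fun t ↦ (Nat.card {x : F // x ^ 3 = 0 - t} : ℂ)]
  simp only [hr, hexp, sum_add_distrib, MulChar.sum_eq_zero_of_ne_one h1,
    MulChar.sum_eq_zero_of_ne_one h1', sum_mulChar_sub h1, sum_mulChar_sub h1',
    sum_mulChar_mul_mulChar_neg, h2, h2', mul_inv_cancel, inv_mul_cancel, sum_one_mulChar,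
    cubic_neg_one hχ, hneg']
  simp only [sum_const, card_univ, nsmul_eq_mul]
  ring

lemma Ncube_three_of_ne_zero (hχ : orderOf χ = 3)
    (hr : ∀ t : F, (Nat.card {x : F // x ^ 3 = t} : ℂ) = 1 + χ t + χ⁻¹ t)
    (hJ : jacobiSum χ χ * jacobiSum χ⁻¹ χ⁻¹ = Fintype.card F) {z : F} (hz : z ≠ 0) :
    (Ncube F 3 z : ℂ) = (Fintype.card F : ℂ) ^ 2 + 3 * Fintype.card F * (χ z + χ⁻¹ z)
      - (jacobiSum χ χ + jacobiSum χ⁻¹ χ⁻¹) := by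
  classical
  obtain ⟨h1, h1', h2, h2'⟩ := cubic_ne_one hχ
  set q : ℂ := (Fintype.card F : ℂ) with hq
  set J := jacobiSum χ χ with hJdef
  set J' := jacobiSum χ⁻¹ χ⁻¹ with hJdef'
  have hN : ∀ t, (Ncube F 2 t : ℂ) = q - 2 + χ⁻¹ t * J + χ t * J' + if t = 0 then 2 * q else 0 := by
    intro t
    split_ifs with ht
    · rw [ht, Ncube_two_zero hχ hr, MulChar.map_zero, MulChar.map_zero]
      ring
    · rw [Ncube_two_of_ne_zero hχ hr ht, add_zero]
  have hexp : ∀ t, (1 + χ t + χ⁻¹ t) * (q - 2 + χ⁻¹ (z - t) * J + χ (z - t) * J'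
        + if z - t = 0 then 2 * q else 0)
      = (q - 2) + (q - 2) * χ t + (q - 2) * χ⁻¹ t + J * χ⁻¹ (z - t) + J' * χ (z - t)
        + J * (χ t * χ⁻¹ (z - t)) + J' * (χ t * χ (z - t)) + J * (χ⁻¹ t * χ⁻¹ (z - t))
        + J' * (χ⁻¹ t * χ (z - t)) + if z = t then (1 + χ t + χ⁻¹ t) * (2 * q) else 0 := fun t ↦ by
    simp only [sub_eq_zero]
    split_ifs <;> ring
  have hinv : χ z * χ⁻¹ z = 1 := by
    rw [← MulChar.mul_apply, mul_inv_cancel, MulChar.one_apply hz.isUnit]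
  rw [Ncube_succ]
  push_cast
  rw [sum_comp_cube fun t ↦ (Ncube F 2 (z - t) : ℂ)]
  simp only [hr, hN, hexp, sum_add_distrib, ← mul_sum, MulChar.sum_eq_zero_of_ne_one h1,
    MulChar.sum_eq_zero_of_ne_one h1', sum_mulChar_sub h1, sum_mulChar_sub h1',
    sum_mulChar_mul_mulChar_sub _ _ hz, sum_ite_eq, mem_univ, if_true]
  rw [jacobiSum_comm χ⁻¹ χ, jacobiSum_nontrivial_inv h1, cubic_neg_one hχ, ← hJdef, ← hJdef']
  have e : χ z * χ z = χ⁻¹ z := by rw [← MulChar.mul_apply, h2]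
  have e' : χ⁻¹ z * χ⁻¹ z = χ z := by rw [← MulChar.mul_apply, h2']
  rw [e, e']
  simp only [sum_const, card_univ, nsmul_eq_mul, ← hq]
  linear_combination (-J - J') * hinv + (χ z + χ⁻¹ z) * hJ

lemma mem_adjoin_cube_root {ω : ℂ} (hω : ω ^ 2 + ω + 1 = 0) {z : ℂ}
    (hz : z ∈ Algebra.adjoin ℤ {ω}) : ∃ x y : ℤ, z = x + y * ω := by
  induction hz using Algebra.adjoin_induction with
  | mem x hx => exact ⟨0, 1, by simpa using hx⟩
  | algebraMap r => exact ⟨r, 0, by simp⟩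
  | add u v _ _ hu hv =>
    obtain ⟨a, b, rfl⟩ := hu
    obtain ⟨a', b', rfl⟩ := hv
    exact ⟨a + a', b + b', by push_cast; ring⟩
  | mul u v _ _ hu hv =>
    obtain ⟨a, b, rfl⟩ := hu
    obtain ⟨a', b', rfl⟩ := hv
    exact ⟨a * a' - b * b', a * b' + b * a' - b * b', by
      push_cast
      linear_combination (b * b' : ℂ) * hω⟩

lemma exists_jacobiSum_cubic (hχ : orderOf χ = 3) (h3 : 3 ∣ Fintype.card F - 1) {ω : ℂ}
    (hω : IsPrimitiveRoot ω 3) :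
    ∃ a b : ℤ, jacobiSum χ χ = (3 * a - 1 : ℤ) + (3 * b : ℤ) * ω := by
  have hω1 : ω ^ 2 + ω + 1 = 0 := by
    have h0 : (ω - 1) * (ω ^ 2 + ω + 1) = 0 := by linear_combination hω.pow_eq_one
    exact (mul_eq_zero.1 h0).resolve_left (sub_ne_zero.2 (hω.ne_one (by norm_num)))
  have hχ3 : χ ^ 3 = 1 := by rw [← hχ, pow_orderOf_eq_one]
  obtain ⟨z, hz, hJ⟩ := exists_jacobiSum_eq_neg_one_add (by norm_num) hχ3 hχ3 h3 hω
  obtain ⟨x, y, rfl⟩ := mem_adjoin_cube_root hω1 hz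
  refine ⟨y, y - x, ?_⟩
  rw [hJ]
  push_cast
  linear_combination (x + y * (ω - 3) : ℂ) * hω1

end CubicCharacter

lemma isPrimitive_of_trace {p : ℕ} [Fact p.Prime] {F : Type*} [Field F] [Finite F]
    [Algebra (ZMod p) F] {ψ : AddChar F ℂ}
    (hψ : ∀ x : F, ψ x = Complex.exp (2 * (Real.pi : ℂ) * Complex.I
      * ((Algebra.trace (ZMod p) F x).val : ℂ) / (p : ℂ))) : ψ.IsPrimitive := by
  have : Module.Finite (ZMod p) F := Module.Finite.of_finite
  refine AddChar.IsPrimitive.of_ne_one ?_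
  rintro rfl
  obtain ⟨x, hx⟩ := Algebra.trace_surjective (ZMod p) F 1
  have h := hψ x
  have hp : p.Prime := Fact.out
  have : Fact (1 < p) := ⟨hp.one_lt⟩
  rw [hx, ZMod.val_one, Nat.cast_one, mul_one, AddChar.one_apply] at h
  exact (Complex.isPrimitiveRoot_exp p hp.ne_zero).ne_one hp.one_lt h.symm

lemma gaussSum_cube {F : Type*} [Field F] [Fintype F] {χ : MulChar F ℂ} (hχ : orderOf χ = 3)
    {ψ : AddChar F ℂ} (hψ : ψ.IsPrimitive) :
    gaussSum χ ψ ^ 3 = Fintype.card F * jacobiSum χ χ := by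
  have h := gaussSum_pow_eq_prod_jacobiSum (χ := χ) (by omega) hψ
  rw [hχ, cubic_neg_one hχ, one_mul] at h
  rw [h]
  simp [show Ico 1 (3 - 1) = {1} from rfl]

end

/-- The table of values of `u_s(z) = N_s(z) - q^{s-1}` for `z = g, g², g³` and
`s = 1, 2, 3`, where `θ(q)` is the sign of the imaginary part of `G(χ,ψ)³`. -/
theorem u_table
    (p k q : ℕ) [Fact p.Prime] (hk : 0 < k) (hq : q = p ^ k) (hq3 : q % 3 = 1)
    (F : Type) [Field F] [Fintype F] [Algebra (ZMod p) F] (hF : Fintype.card F = q)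
    (g : Fˣ) (hg : ∀ x : Fˣ, x ∈ Subgroup.zpowers g)
    (χ : MulChar F ℂ) (hχ : χ (g : F) = (-1 + (Real.sqrt 3 : ℂ) * Complex.I) / 2)
    (ψ : AddChar F ℂ)
    (hψ : ∀ x : F, ψ x = Complex.exp (2 * (Real.pi : ℂ) * Complex.I
      * ((Algebra.trace (ZMod p) F x).val : ℂ) / (p : ℂ)))
    (c d : ℤ) (h4q : 4 * (q : ℤ) = c ^ 2 + 27 * d ^ 2) (hc3 : c % 3 = 1)
    (hd : 0 ≤ d) (hcp : p % 3 = 1 → IsCoprime c (p : ℤ))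
    (θ : ℝ) (hθ : θ = Real.sign ((gaussSum χ ψ ^ 3).im)) :
    (Ncube F 1 ((g : F)) : ℝ) - 1 = -1
    ∧ (Ncube F 1 ((g : F) ^ 2) : ℝ) - 1 = -1
    ∧ (Ncube F 1 ((g : F) ^ 3) : ℝ) - 1 = 2
    ∧ (Ncube F 2 ((g : F)) : ℝ) - (q : ℝ) = -2 - (c : ℝ) / 2 + 9 * (d : ℝ) / 2 * θ
    ∧ (Ncube F 2 ((g : F) ^ 2) : ℝ) - (q : ℝ) = -2 - (c : ℝ) / 2 - 9 * (d : ℝ) / 2 * θ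
    ∧ (Ncube F 2 ((g : F) ^ 3) : ℝ) - (q : ℝ) = -2 + (c : ℝ)
    ∧ (Ncube F 3 ((g : F)) : ℝ) - (q : ℝ) ^ 2 = -3 * (q : ℝ) - (c : ℝ)
    ∧ (Ncube F 3 ((g : F) ^ 2) : ℝ) - (q : ℝ) ^ 2 = -3 * (q : ℝ) - (c : ℝ)
    ∧ (Ncube F 3 ((g : F) ^ 3) : ℝ) - (q : ℝ) ^ 2 = 6 * (q : ℝ) - (c : ℝ) := by
  have hpp : p.Prime := Fact.out
  obtain ⟨n, hn⟩ : ∃ n, 3 * n + 1 = Fintype.card F := ⟨q / 3, by omega⟩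
  have hq1 : 1 < q := hF ▸ Fintype.one_lt_card
  have hnpos : 0 < n := by omega
  have hs2 : (Real.sqrt 3 : ℂ) ^ 2 = 3 := by
    exact_mod_cast Real.sq_sqrt (show (0 : ℝ) ≤ 3 by norm_num)
  set s : ℂ := (Real.sqrt 3 : ℂ) with hs
  set ω : ℂ := (-1 + s * Complex.I) / 2 with hω
  have hω1 : ω ^ 2 + ω + 1 = 0 := by
    rw [hω]
    linear_combination (s ^ 2 / 4) * Complex.I_sq - hs2 / 4
  have hωp : IsPrimitiveRoot ω 3 := by
    have : Fact (Nat.Prime 3) := ⟨Nat.prime_three⟩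
    refine IsPrimitiveRoot.iff_orderOf.2 (orderOf_eq_prime ?_ ?_)
    · linear_combination (ω - 1) * hω1
    · intro h
      rw [h] at hω1
      norm_num at hω1
  have hωc : (starRingEnd ℂ) ω = ω ^ 2 := by
    have : (starRingEnd ℂ) ω = (-1 - s * Complex.I) / 2 := by
      rw [hω, hs]
      simp [sub_eq_add_neg, map_ofNat]
    rw [this]
    linear_combination (-1 : ℂ) * hω1 + (hω : ω = _)
  have hζ := isPrimitiveRoot_generator_pow hg hn
  have hχp : IsPrimitiveRoot (χ g) 3 := hχ ▸ hωp
  have hord := orderOf_cubic hg hχp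
  obtain ⟨h1, h1', h2, h2'⟩ := cubic_ne_one hord
  have hr := natCard_cube_eq hg hζ hχp
  obtain ⟨a, b, hJ⟩ := exists_jacobiSum_cubic hord (by omega) hωp
  have hJ' : jacobiSum χ⁻¹ χ⁻¹ = (3 * a - 1 : ℤ) + (3 * b : ℤ) * ω ^ 2 := by
    have h := congrArg (starRingEnd ℂ) hJ
    have hstar : (starRingEnd ℂ) (jacobiSum χ χ) = jacobiSum χ⁻¹ χ⁻¹ := by
      simp only [jacobiSum, map_sum, map_mul, starRingEnd_apply, MulChar.star_apply']
    rw [hstar] at h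
    rw [h, map_add, map_mul, hωc, map_intCast, map_intCast]
  have hchar : ringChar ℂ ≠ ringChar F := by
    rw [ringChar.eq_zero]
    exact (CharP.ringChar_ne_zero_of_finite F).symm
  have hJJ := jacobiSum_mul_jacobiSum_inv hchar h1 h1 (by rwa [h2])
  have hAB : 4 * (q : ℤ) = (2 * (3 * a - 1) - 3 * b) ^ 2 + 27 * b ^ 2 := by
    have h := hJJ
    rw [hJ, hJ', hF] at h
    have h' : (4 * (q : ℤ) : ℂ) = (((2 * (3 * a - 1) - 3 * b) ^ 2 + 27 * b ^ 2 : ℤ) : ℂ) := by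
      push_cast at h ⊢
      linear_combination -4 * h + (12 * b * (3 * a - 1) + 36 * b ^ 2 * (ω - 1) : ℂ) * hω1
    exact_mod_cast h'
  have hg0 : (g : F) ≠ 0 := g.ne_zero
  have hN2 : ∀ z : F, z ≠ 0 → (Ncube F 2 z : ℂ) = q - 2
      + χ z ^ 2 * ((3 * a - 1 : ℤ) + (3 * b : ℤ) * ω)
      + χ z * ((3 * a - 1 : ℤ) + (3 * b : ℤ) * ω ^ 2) := fun z hz ↦ by
    rw [Ncube_two_of_ne_zero hord hr hz, hJ, hJ', hF, ← h2, MulChar.mul_apply, ← sq]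
  have hN3 : ∀ z : F, z ≠ 0 → (Ncube F 3 z : ℂ) = (q : ℂ) ^ 2 + 3 * q * (χ z + χ z ^ 2)
      - (2 * (3 * a - 1 : ℤ) - (3 * b : ℤ)) := fun z hz ↦ by
    rw [Ncube_three_of_ne_zero hord hr hJJ hz, hJ, hJ', hF, ← h2, MulChar.mul_apply, ← sq]
    linear_combination -(3 * b : ℤ) * hω1
  have hN1 : ∀ z : F, z ≠ 0 → (Ncube F 1 z : ℂ) = 1 + χ z + χ z ^ 2 := fun z hz ↦ by
    rw [Ncube_one, hr, ← h2, MulChar.mul_apply, ← sq]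
  have hsq : c ^ 2 = (2 * (3 * a - 1) - 3 * b) ^ 2 := by
    rw [hq] at h4q hAB
    push_cast at h4q hAB
    have hp3 : p % 3 = 1 ∨ p % 3 = 2 := by
      rcases (by omega : p % 3 = 0 ∨ p % 3 = 1 ∨ p % 3 = 2) with h | h
      · rw [hq, Nat.pow_mod, h, zero_pow hk.ne'] at hq3
        omega
      · exact h
    rcases hp3 with hp3 | hp3
    · have hp2 : p ≠ 2 := by omega
      refine sq_eq_sq_of_not_dvd hp2 k h4q hAB ?_ ?_
      · intro hdvd
        exact (Nat.prime_iff_prime_int.1 hpp).not_isUnit ((hcp hp3).isUnit_of_dvd' hdvd dvd_rfl)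
      · intro hdvd
        have hev : Even n := by
          have hodd : Odd (3 * n + 1) := by
            rw [hn, hF, hq]
            exact (hpp.odd_of_ne_two hp2).pow
          rw [Nat.odd_iff] at hodd
          rw [Nat.even_iff]
          omega
        have hcast := cast_Ncube_two_one hg hn hev hnpos
        have hone : (Ncube F 2 1 : ℤ) = q - 2 + (2 * (3 * a - 1) - 3 * b) := by
          have h := hN2 1 one_ne_zero
          rw [map_one] at h
          have h' : ((Ncube F 2 1 : ℤ) : ℂ) = ((q - 2 + (2 * (3 * a - 1) - 3 * b) : ℤ) : ℂ) := by
            push_cast at h ⊢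
            linear_combination h + (3 * b : ℂ) * hω1
          exact_mod_cast h'
        have : CharP F p := charP_of_injective_algebraMap (algebraMap (ZMod p) F).injective p
        have hone' := congrArg (Int.cast : ℤ → F) hone
        rw [Int.cast_natCast, hcast, Int.cast_add, (CharP.intCast_eq_zero_iff F p _).2 hdvd,
          Int.cast_sub, Int.cast_natCast, hq, Nat.cast_pow, CharP.cast_eq_zero F p, zero_pow hk.ne']
          at hone'
        refine not_dvd_choose_of_three_mul hp3 k n (by rw [hn, hF, hq])
          ((CharP.cast_eq_zero_iff F p ((2 * n).choose n)).1 ?_)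
        push_cast at hone'
        linear_combination -hone'
    · have hd0 := eq_zero_of_four_mul_prime_pow_eq hp3 k _ _ h4q
      have hb0 := eq_zero_of_four_mul_prime_pow_eq hp3 k _ _ hAB
      rw [hd0] at h4q
      rw [hb0] at hAB ⊢
      linear_combination hAB - h4q
  have hcA : c = 2 * (3 * a - 1) - 3 * b := by
    rcases sq_eq_sq_iff_eq_or_eq_neg.1 hsq with h | h
    · exact h
    · omega
  have hdb : d = |b| := by
    rw [← abs_of_nonneg hd]
    refine (sq_eq_sq_iff_abs_eq_abs _ _).1 ?_
    linarith
  have hdθ : (d : ℝ) * θ = b := by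
    have him : (gaussSum χ ψ ^ 3).im = (q * (3 * Real.sqrt 3 / 2)) * b := by
      rw [gaussSum_cube hord (isPrimitive_of_trace hψ), hJ, hF, hω, hs]
      simp [Complex.add_im, Complex.mul_im]
      ring
    have hpos : (0 : ℝ) < q * (3 * Real.sqrt 3 / 2) := by
      have : (0 : ℝ) < q := by exact_mod_cast (by omega : 0 < q)
      positivity
    rw [hθ, him, hdb, Int.cast_abs]
    rcases lt_trichotomy (b : ℝ) 0 with hb | hb | hb
    · rw [Real.sign_of_neg (mul_neg_of_pos_of_neg hpos hb), abs_of_neg hb]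
      ring
    · simp [hb]
    · rw [Real.sign_of_pos (mul_pos hpos hb), abs_of_pos hb, mul_one]
  have hg2 : χ ((g : F) ^ 2) = ω ^ 2 := by rw [map_pow, hχ]
  have hg3 : χ ((g : F) ^ 3) = 1 := by rw [map_pow, hχ, hωp.pow_eq_one]
  have h9 : (9 * d / 2 * θ : ℝ) = 9 * b / 2 := by linear_combination 9 / 2 * hdθ
  have hω3 := hωp.pow_eq_one
  rw [h9, hcA]
  have hz2 := pow_ne_zero 2 hg0
  have hz3 := pow_ne_zero 3 hg0
  refine ⟨?_, ?_, ?_, ?_, ?_, ?_, ?_, ?_, ?_⟩ <;> apply Complex.ofReal_injective <;> push_cast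
  · rw [hN1 _ hg0, hχ]
    linear_combination hω1
  · rw [hN1 _ hz2, hg2]
    linear_combination hω1 + ω * hω3
  · rw [hN1 _ hz3, hg3]
    norm_num
  · rw [hN2 _ hg0, hχ]
    push_cast
    linear_combination (3 * a - 1 : ℂ) * hω1 + (6 * b : ℂ) * hω3
  · rw [hN2 _ hz2, hg2]
    push_cast
    linear_combination (3 * a - 1 + 3 * b : ℂ) * hω1 + (3 * a - 1 : ℂ) * ω * hω3
      + (3 * b : ℂ) * (ω ^ 2 + ω) * hω3
  · rw [hN2 _ hz3, hg3]
    push_cast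
    linear_combination (3 * b : ℂ) * hω1
  · rw [hN3 _ hg0, hχ]
    push_cast
    linear_combination (3 * q : ℂ) * hω1
  · rw [hN3 _ hz2, hg2]
    push_cast
    linear_combination (3 * q : ℂ) * hω1 + (3 * q : ℂ) * ω * hω3
  · rw [hN3 _ hz3, hg3]
    push_cast
    ring
end
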